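/- arXiv:1411.7747 — 5 statements merged into one kernel-verified Lean document; each statement's English description precedes it below -/
import Mathlib

section
/- Let q ≥ 2, k ≥ 2 and NAE := [q]^k ∖ {b̄ : b ∈ [q]}. Let Φ be the NAE-CSP instance on a constraint hypergraph G = (V, E) with E ≠ ∅ and trivial literals (L(e) = 0̄ for all e), and suppose G admits at least one coloring of V with no monochromatic hyperedge. Then the covering number of Φ equals ⌈log_q χ(G)⌉, where χ(G) is the minimum number of colors c for which there is a coloring V → [c] under which no hyperedge e = (v_1, …, v_k) ∈ E has all of v_1, …, v_k receiving the same color. -/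
/-- `c` assignments to `ZMod q` covering every constraint of the NAE instance on `E` are the same
as a coloring with `q ^ c` colors and no monochromatic hyperedge. -/
theorem exists_covering_iff_exists_coloring {ι V : Type*} (q : ℕ) [NeZero q] (E : Set (ι → V))
    [Nonempty ι] (c : ℕ) :
    (∃ F : Fin c → V → ZMod q, ∀ e ∈ E, ∃ t : Fin c, ¬ ∃ b : ZMod q, ∀ i, F t (e i) = b) ↔
      ∃ g : V → Fin (q ^ c), ∀ e ∈ E, ∃ i j, g (e i) ≠ g (e j) := by
  have φ : (Fin c → ZMod q) ≃ Fin (q ^ c) :=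
    Fintype.equivFinOfCardEq (by simp [ZMod.card])
  constructor
  · rintro ⟨F, hF⟩
    refine ⟨fun v => φ fun t => F t v, fun e he => ?_⟩
    obtain ⟨t, ht⟩ := hF e he
    by_contra! h
    obtain ⟨i₀⟩ := ‹Nonempty ι›
    exact ht ⟨F t (e i₀), fun i => congrFun (φ.injective (h i i₀)) t⟩
  · rintro ⟨g, hg⟩
    refine ⟨fun t v => φ.symm (g v) t, fun e he => ?_⟩
    obtain ⟨i, j, hij⟩ := hg e he
    by_contra! h
    refine hij (φ.symm.injective (funext fun t => ?_))
    obtain ⟨b, hb⟩ := h t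
    exact (hb i).trans (hb j).symm

/-- If `chi` is the least number of colors of a coloring with no monochromatic hyperedge, then such
a coloring with `n` colors exists iff `chi ≤ n`. -/
theorem exists_coloring_iff_le {ι V : Type*} {E : Set (ι → V)} {chi : ℕ}
    (hchi : IsLeast {c : ℕ | ∃ g : V → Fin c, ∀ e ∈ E, ∃ i j, g (e i) ≠ g (e j)} chi) (n : ℕ) :
    (∃ g : V → Fin n, ∀ e ∈ E, ∃ i j, g (e i) ≠ g (e j)) ↔ chi ≤ n := by
  refine ⟨fun h => hchi.2 h, fun h => ?_⟩
  obtain ⟨g, hg⟩ := hchi.1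
  refine ⟨fun v => Fin.castLE h (g v), fun e he => ?_⟩
  obtain ⟨i, j, hij⟩ := hg e he
  exact ⟨i, j, fun hc => hij (Fin.castLE_injective h hc)⟩


/-- For the `NAE ⊆ [q]^k` predicate (`q ≥ 2`, `k ≥ 2`) and an instance `Φ` with
trivial literals on a nonempty constraint hypergraph admitting a proper coloring, the covering
number of `Φ` equals `⌈log_q χ(G)⌉`, where `χ(G)` is the least number of colors in a coloring
of `V` with no monochromatic hyperedge.  Here `χ` and `ν` are characterized as least elements
of the corresponding sets of naturals. -/
theorem stmt_2 (q k : ℕ) (hq : 2 ≤ q) (hk : 2 ≤ k) {V : Type*}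
    (E : Set (Fin k → V)) (hE : E.Nonempty) (chi nu : ℕ)
    (hchi : IsLeast {c : ℕ | ∃ g : V → Fin c,
      ∀ e ∈ E, ∃ i j : Fin k, g (e i) ≠ g (e j)} chi)
    (hnu : IsLeast {c : ℕ | ∃ F : Fin c → V → ZMod q,
      ∀ e ∈ E, ∃ t : Fin c, ¬ ∃ b : ZMod q, ∀ i : Fin k, F t (e i) = b} nu) :
    nu = Nat.clog q chi := by
  have : NeZero q := ⟨by lia⟩
  have : Nonempty (Fin k) := ⟨⟨0, by lia⟩⟩
  refine hnu.unique ?_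
  simp only [exists_covering_iff_exists_coloring, exists_coloring_iff_le hchi,
    ← Nat.clog_le_iff_le_pow (show 1 < q by lia)]
  exact isLeast_Ici
end

section
/- Let q ≥ 2, k ≥ 2 and fix a ∈ [q]^k. Let D := {a + b̄ : b ∈ [q]} ⊆ [q]^k and let S := {(y, y') ∈ [q]^k × [q]^k : y ∈ D or y' ∈ D}, viewed as a subset of ([q]²)^k via the identification (y, y') ↦ ((y_1, y'_1), …, (y_k, y'_k)). Then S is connected: for every x, z ∈ S there is a finite sequence of elements of S starting at x and ending at z such that any two consecutive elements of the sequence differ in exactly one of the k coordinates (each coordinate being an element of [q]²). -/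
/-- `x` and `y` are points of `S` that differ in exactly one coordinate. -/
def StepIn {ι α : Type*} (S : Set (ι → α)) (x y : ι → α) : Prop :=
  x ∈ S ∧ y ∈ S ∧ ∃! i, x i ≠ y i

/-- If every coordinatewise mixture of `p` and `r` lies in `S`, then `p` is joined to `r` in `S`
by changing the coordinates one at a time. -/
theorem reflTransGen_stepIn_of_mixtures_mem {ι α : Type*} [Fintype ι] {S : Set (ι → α)}
    {p r : ι → α} (h : ∀ m : ι → α, (∀ i, m i = p i ∨ m i = r i) → m ∈ S) :
    Relation.ReflTransGen (StepIn S) p r := by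
  classical
  have mem (s : Finset ι) : s.piecewise r p ∈ S :=
    h _ fun i => by by_cases hi : i ∈ s <;> simp [hi]
  have key (s : Finset ι) : Relation.ReflTransGen (StepIn S) p (s.piecewise r p) := by
    induction s using Finset.induction_on with
    | empty => simpa using Relation.ReflTransGen.refl
    | insert i s hi ih =>
      by_cases hpr : p i = r i
      · have heq : (insert i s).piecewise r p = s.piecewise r p := by
          rw [Finset.piecewise_insert, ← hpr]
          exact Function.update_eq_self_iff.2 (by simp [hi])
        rwa [heq]
      · refine ih.tail ⟨mem s, mem _, i, by simpa [hi] using hpr, fun j hj => ?_⟩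
        by_contra hji
        exact hj (by simp [hji])
  simpa using key Finset.univ

/-- A pair of points related by the reflexive transitive closure of `R` is joined by a finite
sequence whose consecutive terms are related by `R`. -/
theorem exists_seq_of_reflTransGen {α : Type*} {R : α → α → Prop} {x z : α}
    (h : Relation.ReflTransGen R x z) :
    ∃ (n : ℕ) (w : ℕ → α), w 0 = x ∧ w n = z ∧ ∀ j < n, R (w j) (w (j + 1)) := by
  induction h using Relation.ReflTransGen.head_induction_on with
  | refl => exact ⟨0, fun _ => z, rfl, rfl, by simp⟩
  | @head x y hxy _ ih =>
    obtain ⟨n, w, h0, hn, hw⟩ := ih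
    refine ⟨n + 1, fun j => Nat.casesOn j x w, rfl, hn, ?_⟩
    rintro (_ | j) hj
    · simpa [h0] using hxy
    · exact hw j (by omega)

/-- For `q ≥ 2`, `k ≥ 2` and `a ∈ [q]^k`, with `D := {a + b̄ : b ∈ [q]}` and
`S := {(y, y') : y ∈ D ∨ y' ∈ D} ⊆ ([q]²)^k` (via `(y,y') ↦ ((y_1,y'_1),…,(y_k,y'_k))`),
the set `S` is connected: any two elements of `S` are joined by a sequence inside `S` whose
consecutive elements differ in exactly one of the `k` coordinates. -/
theorem stmt_5 (q k : ℕ) (hq : 2 ≤ q) (hk : 2 ≤ k) (a : Fin k → ZMod q)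
    (S : Set (Fin k → ZMod q × ZMod q))
    (hS : S = {p | (∃ b : ZMod q, ∀ i, (p i).1 = a i + b) ∨
                   (∃ b : ZMod q, ∀ i, (p i).2 = a i + b)}) :
    ∀ x ∈ S, ∀ z ∈ S,
      ∃ (n : ℕ) (w : Fin (n + 1) → Fin k → ZMod q × ZMod q),
        w 0 = x ∧ w (Fin.last n) = z ∧ (∀ j, w j ∈ S) ∧
        ∀ j : Fin n, ∃! i : Fin k, w j.castSucc i ≠ w j.succ i := by
  have hfst {x z : Fin k → ZMod q × ZMod q} (b : ZMod q) (hx : ∀ i, (x i).1 = a i + b)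
      (hz : ∀ i, (z i).1 = a i + b) : Relation.ReflTransGen (StepIn S) x z :=
    reflTransGen_stepIn_of_mixtures_mem fun m hm => by
      rw [hS]
      exact Or.inl ⟨b, fun i => by rcases hm i with h | h <;> simp [h, hx, hz]⟩
  have hsnd {x z : Fin k → ZMod q × ZMod q} (b : ZMod q) (hx : ∀ i, (x i).2 = a i + b)
      (hz : ∀ i, (z i).2 = a i + b) : Relation.ReflTransGen (StepIn S) x z :=
    reflTransGen_stepIn_of_mixtures_mem fun m hm => by
      rw [hS]
      exact Or.inr ⟨b, fun i => by rcases hm i with h | h <;> simp [h, hx, hz]⟩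
  have joined {x z : Fin k → ZMod q × ZMod q} (hx : x ∈ S) (hz : z ∈ S) :
      Relation.ReflTransGen (StepIn S) x z := by
    rw [hS] at hx hz
    rcases hx with ⟨b, hx⟩ | ⟨b, hx⟩ <;> rcases hz with ⟨c, hz⟩ | ⟨c, hz⟩
    · exact ((hfst (z := fun i => (a i + b, a i + 0)) b hx fun _ => rfl).trans
        (hsnd (z := fun i => (a i + c, a i + 0)) 0 (fun _ => rfl) fun _ => rfl)).trans
        (hfst c (fun _ => rfl) hz)
    · exact (hfst (z := fun i => (a i + b, a i + c)) b hx fun _ => rfl).trans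
        (hsnd c (fun _ => rfl) hz)
    · exact (hsnd (z := fun i => (a i + c, a i + b)) b hx fun _ => rfl).trans
        (hfst c (fun _ => rfl) hz)
    · exact ((hsnd (z := fun i => (a i + 0, a i + b)) b hx fun _ => rfl).trans
        (hfst (z := fun i => (a i + 0, a i + c)) 0 (fun _ => rfl) fun _ => rfl)).trans
        (hsnd c (fun _ => rfl) hz)
  intro x hx z hz
  obtain ⟨n, w, h0, hn, hw⟩ := exists_seq_of_reflTransGen (joined hx hz)
  refine ⟨n, fun j => w j, h0, by simpa using hn, ?_, fun j => (hw j j.isLt).2.2⟩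
  rintro ⟨_ | j, hj⟩
  · simpa [h0] using hx
  · exact (hw j (by omega)).2.1
end

section
/- Let G = (U, V, E, [L], [L], {π_e}) be a Unique-Games instance, q ≥ 2, k ≥ 2, a ∈ [q]^k, and let P ⊆ [q]^k be a predicate with {a + b̄ : b ∈ [q]} ⊆ P. Let 𝒢 be the P-CSP instance produced by the long code test 𝒯₁. If G is c-coverable, then 𝒢 is 2c-coverable; indeed, if ℓ_1, …, ℓ_c are labelings witnessing c-coverability of G, then the 2c assignments f_v^i(x) := x_{ℓ_i(v)} and g_v^i(x) := x_{ℓ_i(v)+L} (for i = 1, …, c) form a 2c-covering of 𝒢. -/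
/-- Composition `x ∘ π` of a string `x ∈ [q]^{2L}` (indexed by `Fin L ⊕ Fin L`, the left
summand being positions `0, …, L-1` and the right summand positions `L, …, 2L-1`) with a
permutation `π` of `[L]`: `(x ∘ π)(i) = x_{π(i)}` on the first half and
`(x ∘ π)(i) = x_{π(i-L)+L}` on the second half. -/
def compQ {q L : ℕ} (π : Fin L → Fin L) (x : (Fin L ⊕ Fin L) → ZMod q) :
    (Fin L ⊕ Fin L) → ZMod q :=
  fun c => match c with
  | Sum.inl i => x (Sum.inl (π i))
  | Sum.inr i => x (Sum.inr (π i))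

/-- completeness of the long code test `𝒯₁`: if the Unique-Games instance
`G` is `c`-coverable via labelings `ℓ_1, …, ℓ_c`, then the `2c` assignments
`f_v^i(x) := x_{ℓ_i(v)}` and `g_v^i(x) := x_{ℓ_i(v)+L}` cover every constraint of the
`P`-CSP instance `𝒢` produced by `𝒯₁` (for any predicate `P ⊇ {a + b̄ : b ∈ [q]}`):
for each test tuple `(u, w_1, …, w_k, X)` in the support of `𝒯₁` there are `i ∈ [c]` and a
half `h ∈ {0,1}` such that the corresponding queried values lie in `P`. -/
theorem stmt_6 (q k L c : ℕ) (hq : 2 ≤ q) (hk : 2 ≤ k)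
    {U V : Type} (Adj : U → V → Prop)
    (π : U → V → Fin L → Fin L) (hbij : ∀ u v, Function.Bijective (π u v))
    (a : Fin k → ZMod q) (P : Set (Fin k → ZMod q))
    (hP : ∀ b : ZMod q, (fun r => a r + b) ∈ P)
    (ℓU : Fin c → U → Fin L) (ℓV : Fin c → V → Fin L)
    (hcov : ∀ u : U, ∃ i : Fin c, ∀ v : V, Adj u v → π u v (ℓV i v) = ℓU i u) :
    ∀ (u : U) (w : Fin k → V) (X : Fin k → (Fin L ⊕ Fin L) → ZMod q),
      (∀ j, Adj u (w j)) →
      (∀ i : Fin L, (∃ b : ZMod q, ∀ r, X r (Sum.inl i) = a r + b) ∨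
                    (∃ b : ZMod q, ∀ r, X r (Sum.inr i) = a r + b)) →
      ∃ (i : Fin c) (h : Bool),
        (fun j => compQ (π u (w j)) (X j)
            (if h then Sum.inr (ℓV i (w j)) else Sum.inl (ℓV i (w j)))) ∈ P := by
  intro u w X hw hX
  obtain ⟨i, hi⟩ := hcov u
  rcases hX (ℓU i u) with ⟨b, hb⟩ | ⟨b, hb⟩
  · refine ⟨i, false, ?_⟩
    convert hP b using 2 with j
    simpa [compQ, hi _ (hw j)] using hb j
  · refine ⟨i, true, ?_⟩
    convert hP b using 2 with j
    simpa [compQ, hi _ (hw j)] using hb j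
end

section
/- Let q ≥ 2, k ≥ 2 and a ∈ [q]^k. For every constant δ > 0 there exists a constant s > 0 (depending only on δ, q, k) such that the following holds for every Unique-Games instance G = (U, V, E, [L], [L], {π_e}) with bi-regular bipartite graph: if every labeling of G satisfies at most an s fraction of the edges, then the constraint hypergraph of the instance 𝒢 produced by the long code test 𝒯₁ has no independent set of fractional size δ; that is, there is no subset I ⊆ V × [q]^{2L} with |I| ≥ δ·|V|·q^{2L} such that no constraint tuple occurring with positive probability under 𝒯₁ has all of its k queried variables in I. -/
section LongCodeTest

open Finset

set_option linter.unusedSectionVars false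

/-- The weight of a point of the finite product space with marginal weights `μ`. -/
def prodWeight {ι Ω : Type*} [Fintype ι] (μ : Ω → ℝ) (x : ι → Ω) : ℝ := ∏ i, μ (x i)

/-- The expectation of `f` with respect to the product weights. -/
def prodExpect {ι Ω : Type*} [Fintype ι] [DecidableEq ι] [Fintype Ω] (μ : Ω → ℝ)
    (f : (ι → Ω) → ℝ) : ℝ := ∑ x, prodWeight μ x * f x

/-- The conditional expectation of `f` obtained by averaging over the coordinates in `S`. -/
def partialAvg {ι Ω : Type*} [Fintype ι] [DecidableEq ι] [Fintype Ω] (μ : Ω → ℝ)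
    (S : Finset ι) (f : (ι → Ω) → ℝ) (x : ι → Ω) : ℝ :=
  ∑ y, prodWeight μ y * f (S.piecewise y x)

/-- The `L²` influence of the coordinate `i` on `f`. -/
def influence {ι Ω : Type*} [Fintype ι] [DecidableEq ι] [Fintype Ω] (μ : Ω → ℝ)
    (i : ι) (f : (ι → Ω) → ℝ) : ℝ :=
  prodExpect μ (fun x => (f x - partialAvg μ {i} f x) ^ 2)

section ProductSpace

variable {ι Ω : Type*} [Fintype ι] [DecidableEq ι] [Fintype Ω] {μ : Ω → ℝ}

lemma prodWeight_nonneg (h0 : ∀ s, 0 ≤ μ s) (x : ι → Ω) : 0 ≤ prodWeight μ x :=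
  Finset.prod_nonneg fun i _ => h0 (x i)

lemma sum_prodWeight (h1 : ∑ s, μ s = 1) : ∑ x : ι → Ω, prodWeight μ x = 1 := by
  unfold prodWeight
  rw [← Fintype.prod_sum (fun (_ : ι) s => μ s)]
  simp [h1]

lemma prodExpect_const (h1 : ∑ s, μ s = 1) (c : ℝ) : prodExpect μ (fun _ : ι → Ω => c) = c := by
  simp [prodExpect, ← Finset.sum_mul, sum_prodWeight h1]

lemma prodExpect_mono (h0 : ∀ s, 0 ≤ μ s) {f g : (ι → Ω) → ℝ} (h : ∀ x, f x ≤ g x) :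
    prodExpect μ f ≤ prodExpect μ g :=
  Finset.sum_le_sum fun x _ => mul_le_mul_of_nonneg_left (h x) (prodWeight_nonneg h0 x)

lemma prodExpect_nonneg (h0 : ∀ s, 0 ≤ μ s) {f : (ι → Ω) → ℝ} (h : ∀ x, 0 ≤ f x) :
    0 ≤ prodExpect μ f :=
  Finset.sum_nonneg fun x _ => mul_nonneg (prodWeight_nonneg h0 x) (h x)

lemma prodExpect_add (f g : (ι → Ω) → ℝ) :
    prodExpect μ (fun x => f x + g x) = prodExpect μ f + prodExpect μ g := by
  simp [prodExpect, mul_add, Finset.sum_add_distrib]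

lemma prodExpect_sub (f g : (ι → Ω) → ℝ) :
    prodExpect μ (fun x => f x - g x) = prodExpect μ f - prodExpect μ g := by
  simp [prodExpect, mul_sub, Finset.sum_sub_distrib]

lemma prodExpect_const_mul (c : ℝ) (f : (ι → Ω) → ℝ) :
    prodExpect μ (fun x => c * f x) = c * prodExpect μ f := by
  simp only [prodExpect, Finset.mul_sum]
  exact Finset.sum_congr rfl fun x _ => by ring

lemma partialAvg_eq_prodExpect (S : Finset ι) (f : (ι → Ω) → ℝ) (x : ι → Ω) :
    partialAvg μ S f x = prodExpect μ (fun y => f (S.piecewise y x)) := rfl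

lemma partialAvg_univ (f : (ι → Ω) → ℝ) (x : ι → Ω) :
    partialAvg μ univ f x = prodExpect μ f := by
  simp [partialAvg, prodExpect]

lemma partialAvg_empty (h1 : ∑ s, μ s = 1) (f : (ι → Ω) → ℝ) :
    partialAvg μ ∅ f = f := by
  funext x
  simp [partialAvg, ← Finset.sum_mul, sum_prodWeight h1]

lemma prodExpect_prodExpect_piecewise (h1 : ∑ s, μ s = 1) (S : Finset ι) (f : (ι → Ω) → ℝ) :
    prodExpect μ (fun y => prodExpect μ (fun z => f (S.piecewise z y))) = prodExpect μ f := by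
  have key : ∑ p : (ι → Ω) × (ι → Ω),
      prodWeight μ p.1 * prodWeight μ p.2 * f (S.piecewise p.2 p.1) =
      ∑ p : (ι → Ω) × (ι → Ω), prodWeight μ p.1 * prodWeight μ p.2 * f p.1 := by
    refine Fintype.sum_bijective
      (fun p => (S.piecewise p.2 p.1, S.piecewise p.1 p.2)) ?_ _ _ ?_
    · refine Function.Involutive.bijective fun p => ?_
      ext i <;> by_cases hi : i ∈ S <;> simp [hi]
    · rintro ⟨y, z⟩
      simp only [prodWeight, ← Finset.prod_mul_distrib]
      congr 1
      refine Finset.prod_congr rfl fun i _ => ?_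
      by_cases hi : i ∈ S <;> simp [hi, mul_comm]
  rw [Fintype.sum_prod_type, Fintype.sum_prod_type] at key
  have h2 : prodExpect μ (fun y => prodExpect μ (fun z => f (S.piecewise z y))) =
      ∑ y : ι → Ω, ∑ z, prodWeight μ y * prodWeight μ z * f (S.piecewise z y) := by
    simp only [prodExpect, Finset.mul_sum, mul_assoc]
  rw [h2, key]
  refine Finset.sum_congr rfl fun y _ => ?_
  simp only [← Finset.sum_mul, ← Finset.mul_sum, sum_prodWeight h1, mul_one]

lemma prodExpect_partialAvg (h1 : ∑ s, μ s = 1) (S : Finset ι) (f : (ι → Ω) → ℝ) :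
    prodExpect μ (partialAvg μ S f) = prodExpect μ f :=
  prodExpect_prodExpect_piecewise h1 S f

lemma partialAvg_partialAvg (h1 : ∑ s, μ s = 1) (S T : Finset ι) (f : (ι → Ω) → ℝ) :
    partialAvg μ S (partialAvg μ T f) = partialAvg μ (S ∪ T) f := by
  funext x
  rw [partialAvg_eq_prodExpect (S ∪ T),
    ← prodExpect_prodExpect_piecewise h1 T (fun y => f ((S ∪ T).piecewise y x))]
  rw [partialAvg_eq_prodExpect]
  congr 1
  funext y
  rw [partialAvg_eq_prodExpect]
  congr 1
  funext z
  congr 1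
  ext i
  by_cases hT : i ∈ T <;> by_cases hS : i ∈ S <;> simp [hT, hS]

lemma partialAvg_comm (h1 : ∑ s, μ s = 1) (S T : Finset ι) (f : (ι → Ω) → ℝ) :
    partialAvg μ S (partialAvg μ T f) = partialAvg μ T (partialAvg μ S f) := by
  rw [partialAvg_partialAvg h1, partialAvg_partialAvg h1, Finset.union_comm]

lemma partialAvg_sub (S : Finset ι) (f g : (ι → Ω) → ℝ) :
    partialAvg μ S (fun x => f x - g x) =
      fun x => partialAvg μ S f x - partialAvg μ S g x := by
  funext x
  exact prodExpect_sub _ _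

/-- `χ` does not depend on the coordinates in `S`. -/
def IndepOf (S : Finset ι) (χ : (ι → Ω) → ℝ) : Prop :=
  ∀ x y, χ (S.piecewise y x) = χ x

lemma indepOf_partialAvg (S : Finset ι) (f : (ι → Ω) → ℝ) :
    IndepOf S (partialAvg μ S f) := by
  intro x y
  simp only [partialAvg]
  refine Finset.sum_congr rfl fun z _ => ?_
  congr 2
  ext i
  by_cases hi : i ∈ S <;> simp [hi]

lemma partialAvg_mul_indepOf {S : Finset ι} {χ : (ι → Ω) → ℝ} (hχ : IndepOf S χ)
    (f : (ι → Ω) → ℝ) (x : ι → Ω) :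
    partialAvg μ S (fun x => f x * χ x) x = partialAvg μ S f x * χ x := by
  simp only [partialAvg, Finset.sum_mul]
  refine Finset.sum_congr rfl fun z _ => ?_
  rw [hχ x z]; ring

lemma prodExpect_mul_indepOf (h1 : ∑ s, μ s = 1) {S : Finset ι} {χ : (ι → Ω) → ℝ}
    (hχ : IndepOf S χ) (f : (ι → Ω) → ℝ) :
    prodExpect μ (fun x => partialAvg μ S f x * χ x) = prodExpect μ (fun x => f x * χ x) := by
  rw [← prodExpect_partialAvg h1 S (fun x => f x * χ x)]
  congr 1
  funext x
  exact (partialAvg_mul_indepOf hχ f x).symm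

lemma prodExpect_sub_partialAvg_sq (h1 : ∑ s, μ s = 1) (S : Finset ι) (f : (ι → Ω) → ℝ) :
    prodExpect μ (fun x => (f x - partialAvg μ S f x) ^ 2) =
      prodExpect μ (fun x => f x ^ 2) - prodExpect μ (fun x => partialAvg μ S f x ^ 2) := by
  have h := prodExpect_mul_indepOf h1 (indepOf_partialAvg (μ := μ) S f) f
  have h2 : (fun x => (f x - partialAvg μ S f x) ^ 2) = fun x =>
      f x ^ 2 - 2 * (f x * partialAvg μ S f x) + partialAvg μ S f x ^ 2 := by
    funext x; ring
  rw [h2, prodExpect_add, prodExpect_sub, prodExpect_const_mul, ← h]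
  simp only [← pow_two]
  ring

lemma prodExpect_partialAvg_sq_le (h0 : ∀ s, 0 ≤ μ s) (h1 : ∑ s, μ s = 1) (S : Finset ι)
    (f : (ι → Ω) → ℝ) :
    prodExpect μ (fun x => partialAvg μ S f x ^ 2) ≤ prodExpect μ (fun x => f x ^ 2) := by
  have h := prodExpect_sub_partialAvg_sq h1 S f
  have h2 : 0 ≤ prodExpect μ (fun x => (f x - partialAvg μ S f x) ^ 2) :=
    prodExpect_nonneg h0 fun x => sq_nonneg _
  linarith

lemma sq_prodExpect_le (h0 : ∀ s, 0 ≤ μ s) (h1 : ∑ s, μ s = 1) (f : (ι → Ω) → ℝ) :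
    prodExpect μ f ^ 2 ≤ prodExpect μ (fun x => f x ^ 2) := by
  have h := prodExpect_partialAvg_sq_le h0 h1 univ f
  simpa only [partialAvg_univ, prodExpect_const h1] using h

lemma partialAvg_nonneg (h0 : ∀ s, 0 ≤ μ s) (S : Finset ι) {f : (ι → Ω) → ℝ}
    (h : ∀ x, 0 ≤ f x) (x : ι → Ω) : 0 ≤ partialAvg μ S f x :=
  prodExpect_nonneg h0 fun _ => h _

lemma partialAvg_mono (h0 : ∀ s, 0 ≤ μ s) (S : Finset ι) {f g : (ι → Ω) → ℝ}
    (h : ∀ x, f x ≤ g x) (x : ι → Ω) : partialAvg μ S f x ≤ partialAvg μ S g x :=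
  prodExpect_mono h0 fun _ => h _

lemma abs_partialAvg_le (h0 : ∀ s, 0 ≤ μ s) (S : Finset ι) (f : (ι → Ω) → ℝ) (x : ι → Ω) :
    |partialAvg μ S f x| ≤ partialAvg μ S (fun y => |f y|) x := by
  refine (Finset.abs_sum_le_sum_abs _ _).trans (le_of_eq ?_)
  refine Finset.sum_congr rfl fun y _ => ?_
  rw [abs_mul, abs_of_nonneg (prodWeight_nonneg h0 y)]

lemma pow_card_mul_le_partialAvg {l : ℝ} (hl : 0 ≤ l) (hμ : ∀ s, l ≤ μ s)
    (h1 : ∑ s, μ s = 1) (S : Finset ι) {f : (ι → Ω) → ℝ} (h : ∀ x, 0 ≤ f x) (x : ι → Ω) :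
    l ^ S.card * f x ≤ partialAvg μ S f x := by
  classical
  have h0 : ∀ s, 0 ≤ μ s := fun s => hl.trans (hμ s)
  let g : ι → Ω → ℝ := fun i s => if i ∈ S then (if s = x i then μ s else 0) else μ s
  have hg : ∑ y : ι → Ω, ∏ i, g i (y i) = ∏ i ∈ S, μ (x i) := by
    rw [← Fintype.prod_sum g, ← Finset.prod_subset (Finset.subset_univ S)]
    · refine Finset.prod_congr rfl fun i hi => ?_
      simp [g, hi]
    · intro i _ hi
      simp [g, hi, h1]
  calc l ^ S.card * f x ≤ (∏ i ∈ S, μ (x i)) * f x := by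
        refine mul_le_mul_of_nonneg_right ?_ (h x)
        rw [← Finset.prod_const]
        exact Finset.prod_le_prod (fun _ _ => hl) fun i _ => hμ _
    _ = ∑ y : ι → Ω, (∏ i, g i (y i)) * f x := by rw [← hg, Finset.sum_mul]
    _ ≤ partialAvg μ S f x := by
        refine Finset.sum_le_sum fun y _ => ?_
        by_cases hy : ∀ i ∈ S, y i = x i
        · have e1 : S.piecewise y x = x := by
            ext i
            by_cases hi : i ∈ S
            · simp [hi, hy i hi]
            · simp [hi]
          rw [e1]
          refine mul_le_mul_of_nonneg_right ?_ (h x)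
          refine le_of_eq (Finset.prod_congr rfl fun i _ => ?_)
          by_cases hi : i ∈ S
          · simp [g, hi, hy i hi]
          · simp [g, hi]
        · push Not at hy
          obtain ⟨i, hi, hne⟩ := hy
          have e1 : ∏ i, g i (y i) = 0 :=
            Finset.prod_eq_zero (Finset.mem_univ i) (by simp [g, hi, hne])
          rw [e1, zero_mul]
          exact mul_nonneg (prodWeight_nonneg h0 y) (h _)

lemma mul_le_partialAvg_singleton {l : ℝ} (hl : 0 ≤ l) (hμ : ∀ s, l ≤ μ s)
    (h1 : ∑ s, μ s = 1) (i : ι) {f : (ι → Ω) → ℝ} (h : ∀ x, 0 ≤ f x) (x : ι → Ω) :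
    l * f x ≤ partialAvg μ {i} f x := by
  simpa using pow_card_mul_le_partialAvg hl hμ h1 {i} h x

lemma mul_log_sub_mul_log_ge {h m c : ℝ} (hh : 0 ≤ h) (hm : 0 ≤ m) (h0 : m = 0 → h = 0)
    (hc : 0 < c) : h * Real.log c + h - c * m ≤ h * Real.log h - h * Real.log m := by
  rcases hh.eq_or_lt with rfl | hpos
  · simp; positivity
  have hmpos : 0 < m := lt_of_le_of_ne hm fun e => hpos.ne' (h0 e.symm)
  have := Real.log_le_sub_one_of_pos (x := c * m / h) (by positivity)
  rw [Real.log_div (by positivity) hpos.ne', Real.log_mul hc.ne' hmpos.ne'] at this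
  have h2 := mul_le_mul_of_nonneg_left this hh
  have h3 : h * (c * m / h - 1) = c * m - h := by field_simp
  rw [h3] at h2
  nlinarith

lemma prodExpect_mul_log_partialAvg (h1 : ∑ s, μ s = 1) (S : Finset ι) (f : (ι → Ω) → ℝ) :
    prodExpect μ (fun x => partialAvg μ S f x * Real.log (partialAvg μ S f x)) =
      prodExpect μ (fun x => f x * Real.log (partialAvg μ S f x)) :=
  prodExpect_mul_indepOf h1 (χ := fun x => Real.log (partialAvg μ S f x))
    (fun x y => congrArg Real.log (indepOf_partialAvg S f x y)) f

lemma entropy_partialAvg_le {l : ℝ} (hl : 0 < l) (hμ : ∀ s, l ≤ μ s) (h1 : ∑ s, μ s = 1)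
    (S : Finset ι) (j : ι) {h : (ι → Ω) → ℝ} (hh : ∀ x, 0 ≤ h x) :
    prodExpect μ (fun x => partialAvg μ S h x * Real.log (partialAvg μ S h x)) -
      prodExpect μ (fun x => partialAvg μ {j} (partialAvg μ S h) x *
        Real.log (partialAvg μ {j} (partialAvg μ S h) x)) ≤
    prodExpect μ (fun x => h x * Real.log (h x)) -
      prodExpect μ (fun x => partialAvg μ {j} h x * Real.log (partialAvg μ {j} h x)) := by
  have h0 : ∀ s, 0 ≤ μ s := fun s => hl.le.trans (hμ s)
  rw [prodExpect_mul_log_partialAvg h1 {j} (partialAvg μ S h),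
    prodExpect_mul_log_partialAvg h1 {j} h, ← prodExpect_sub, ← prodExpect_sub,
    ← prodExpect_partialAvg h1 S (fun x => h x * _ - _)]
  refine prodExpect_mono h0 fun x => ?_
  rw [partialAvg_comm h1 {j} S]
  set m := partialAvg μ {j} h with hm
  have hm0 : ∀ x, 0 ≤ m x := partialAvg_nonneg h0 _ hh
  have hmz : ∀ (f : (ι → Ω) → ℝ), (∀ x, 0 ≤ f x) → ∀ x, partialAvg μ {j} f x = 0 → f x = 0 := by
    intro f hf x hx
    have := mul_le_partialAvg_singleton hl.le hμ h1 j hf x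
    rw [hx] at this
    exact le_antisymm (by by_contra hlt; push Not at hlt; nlinarith [mul_pos hl hlt]) (hf x)
  have ha0 : 0 ≤ partialAvg μ S h x := partialAvg_nonneg h0 _ hh x
  have hb0 : 0 ≤ partialAvg μ S m x := partialAvg_nonneg h0 _ hm0 x
  have hab : partialAvg μ S m x = 0 → partialAvg μ S h x = 0 := by
    intro hx
    refine hmz _ (partialAvg_nonneg h0 _ hh) x ?_
    rw [partialAvg_comm h1 {j} S, ← hm, hx]
  have key : ∀ c : ℝ, 0 < c →
      partialAvg μ S h x * Real.log c + partialAvg μ S h x - c * partialAvg μ S m x ≤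
      partialAvg μ S (fun x => h x * Real.log (h x) - h x * Real.log (m x)) x := by
    intro c hc
    have e := partialAvg_mono h0 S (fun y => mul_log_sub_mul_log_ge (hh y) (hm0 y)
      (fun e => hmz h hh y e) hc) x
    refine le_trans (le_of_eq ?_) e
    simp only [partialAvg_eq_prodExpect]
    rw [prodExpect_sub, prodExpect_add, prodExpect_const_mul]
    congr 2
    rw [mul_comm, ← prodExpect_const_mul]
    congr 1; funext y; ring
  set a := partialAvg μ S h x
  set b := partialAvg μ S m x
  set X := partialAvg μ S (fun x => h x * Real.log (h x) - h x * Real.log (m x)) x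
  rcases hb0.eq_or_lt with hb | hb
  · have := hab hb.symm
    have k := key 1 one_pos
    rw [← hb, this] at k
    rw [this]; simpa using k
  rcases ha0.eq_or_lt with ha | ha
  · rw [← ha]
    simp only [zero_mul, sub_zero]
    by_contra hX
    push Not at hX
    have k := key (-X / (2 * b)) (by apply div_pos <;> linarith)
    rw [← ha] at k
    have : -X / (2 * b) * b = -X / 2 := by field_simp
    rw [this] at k
    linarith
  · have k := key (a / b) (by positivity)
    rw [Real.log_div ha.ne' hb.ne'] at k
    have : a / b * b = a := by field_simp
    rw [this] at k
    linarith

lemma entropy_singleton_le {l : ℝ} (hl : 0 < l) (hμ : ∀ s, l ≤ μ s) (h1 : ∑ s, μ s = 1)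
    (j : ι) (g : (ι → Ω) → ℝ) :
    prodExpect μ (fun x => g x ^ 2 * Real.log (g x ^ 2)) -
      prodExpect μ (fun x => partialAvg μ {j} (fun y => g y ^ 2) x *
        Real.log (partialAvg μ {j} (fun y => g y ^ 2) x)) ≤
    (2 * (1 / l + 1)) * influence μ j g := by
  have h0 : ∀ s, 0 ≤ μ s := fun s => hl.le.trans (hμ s)
  rw [prodExpect_mul_log_partialAvg h1]
  set p := partialAvg μ {j} g with hp
  set m := partialAvg μ {j} (fun y => g y ^ 2) with hm
  let χ : (ι → Ω) → ℝ := fun x => 1 - 2 * (m x - p x ^ 2) / m x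
  have hχ : IndepOf {j} χ := by
    intro x y
    simp only [χ, hm, hp, indepOf_partialAvg ({j} : Finset ι) _ x y]
  have hz : prodExpect μ (fun x => (g x ^ 2 - m x) * χ x) = 0 := by
    have e : (fun x => (g x ^ 2 - m x) * χ x) = fun x => g x ^ 2 * χ x - m x * χ x := by
      funext x; ring
    rw [e, prodExpect_sub, hm, prodExpect_mul_indepOf h1 hχ, sub_self]
  rw [← prodExpect_sub, influence, ← prodExpect_const_mul]
  rw [← add_zero (prodExpect μ fun x => 2 * (1 / l + 1) * _), ← hz, ← prodExpect_add]
  refine prodExpect_mono h0 fun x => ?_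
  have hm0 : 0 ≤ m x := partialAvg_nonneg h0 _ (fun y => sq_nonneg _) x
  have hgm : l * g x ^ 2 ≤ m x :=
    mul_le_partialAvg_singleton hl.le hμ h1 j (fun y => sq_nonneg (g y)) x
  have hpm : p x ^ 2 ≤ m x := sq_prodExpect_le h0 h1 _
  rcases hm0.eq_or_lt with e | hmpos
  · have hg : g x ^ 2 = 0 := by
      rw [← e] at hgm
      nlinarith [sq_nonneg (g x)]
    rw [hg, ← e]
    simp only [zero_mul, sub_zero]
    have : 0 ≤ 1 / l := by positivity
    positivity
  have hgm' : g x ^ 2 ≤ m x / l := by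
    rw [le_div_iff₀ hl]; linarith
  have hlog : g x ^ 2 * Real.log (g x ^ 2) - g x ^ 2 * Real.log (m x) ≤
      g x ^ 2 * (g x ^ 2 / m x - 1) := by
    rcases (sq_nonneg (g x)).eq_or_lt with e | hpos
    · rw [← e]; simp
    · rw [← mul_sub, ← Real.log_div hpos.ne' hmpos.ne']
      exact mul_le_mul_of_nonneg_left (Real.log_le_sub_one_of_pos (by positivity)) hpos.le
  refine hlog.trans ?_
  have e1 : g x ^ 2 * (g x ^ 2 / m x - 1) = (g x ^ 2 - p x ^ 2) ^ 2 / m x +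
      (g x ^ 2 - m x) * χ x - (m x - p x ^ 2) ^ 2 / m x := by
    simp only [χ]
    field_simp
    ring
  have e2 : (g x ^ 2 - p x ^ 2) ^ 2 / m x ≤ 2 * (1 / l + 1) * (g x - p x) ^ 2 := by
    rw [div_le_iff₀ hmpos]
    have e3 : (g x + p x) ^ 2 ≤ 2 * (1 / l + 1) * m x := by
      have : 2 * (1 / l + 1) * m x = 2 * (m x / l + m x) := by ring
      rw [this]
      nlinarith [sq_nonneg (g x - p x)]
    calc (g x ^ 2 - p x ^ 2) ^ 2 = (g x - p x) ^ 2 * (g x + p x) ^ 2 := by ring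
      _ ≤ (g x - p x) ^ 2 * (2 * (1 / l + 1) * m x) :=
        mul_le_mul_of_nonneg_left e3 (sq_nonneg _)
      _ = _ := by ring
  have e4 : 0 ≤ (m x - p x ^ 2) ^ 2 / m x := by positivity
  rw [e1]
  linarith

/-- A logarithmic Sobolev inequality on a finite product space. -/
lemma entropy_sq_le {l : ℝ} (hl : 0 < l) (hμ : ∀ s, l ≤ μ s) (h1 : ∑ s, μ s = 1)
    (g : (ι → Ω) → ℝ) :
    prodExpect μ (fun x => g x ^ 2 * Real.log (g x ^ 2)) -
      prodExpect μ (fun x => g x ^ 2) * Real.log (prodExpect μ (fun x => g x ^ 2)) ≤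
    (2 * (1 / l + 1)) * ∑ j, influence μ j g := by
  have key : ∀ S : Finset ι, prodExpect μ (fun x => g x ^ 2 * Real.log (g x ^ 2)) -
      prodExpect μ (fun x => partialAvg μ S (fun y => g y ^ 2) x *
        Real.log (partialAvg μ S (fun y => g y ^ 2) x)) ≤
      (2 * (1 / l + 1)) * ∑ j ∈ S, influence μ j g := by
    intro S
    induction S using Finset.induction_on with
    | empty => rw [partialAvg_empty h1]; simp
    | insert j S hj ih =>
      rw [Finset.sum_insert hj, Finset.insert_eq, ← partialAvg_partialAvg h1]
      have e1 := entropy_partialAvg_le hl hμ h1 S j (h := fun y => g y ^ 2)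
        (fun y => sq_nonneg _)
      have e2 := entropy_singleton_le hl hμ h1 j g
      linarith
  have := key univ
  simpa only [partialAvg_univ, prodExpect_const h1] using this

lemma two_mul_log_div_le_entropy (h0 : ∀ s, 0 ≤ μ s) (g : (ι → Ω) → ℝ)
    (hv : 0 < prodExpect μ (fun x => g x ^ 2)) (he : 0 < prodExpect μ (fun x => |g x|)) :
    2 * prodExpect μ (fun x => g x ^ 2) *
      Real.log (prodExpect μ (fun x => g x ^ 2) / prodExpect μ (fun x => |g x|)) ≤
    prodExpect μ (fun x => g x ^ 2 * Real.log (g x ^ 2)) := by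
  set v := prodExpect μ (fun x => g x ^ 2)
  set e := prodExpect μ (fun x => |g x|)
  have key : prodExpect μ (fun x => (2 * Real.log (v / e)) * g x ^ 2 + 2 * g x ^ 2 -
      (2 * v / e) * |g x|) ≤ prodExpect μ (fun x => g x ^ 2 * Real.log (g x ^ 2)) := by
    refine prodExpect_mono h0 fun x => ?_
    rcases eq_or_ne (g x) 0 with hx | hx
    · simp [hx]
    have hpos : 0 < |g x| := abs_pos.mpr hx
    have hl := Real.log_le_sub_one_of_pos (x := (v / e) / |g x|) (by positivity)
    rw [Real.log_div (by positivity) hpos.ne'] at hl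
    have e1 : Real.log (g x ^ 2) = 2 * Real.log |g x| := by
      rw [← sq_abs, Real.log_pow]; norm_num
    have h2 := mul_le_mul_of_nonneg_left hl (sq_nonneg (g x))
    have e2 : g x ^ 2 * (v / e / |g x| - 1) = v / e * |g x| - g x ^ 2 := by
      rw [← sq_abs]; field_simp
    rw [e2] at h2
    rw [e1]
    have e3 : 2 * v / e * |g x| = 2 * (v / e * |g x|) := by ring
    rw [e3]
    nlinarith
  rw [prodExpect_sub, prodExpect_add, prodExpect_const_mul, prodExpect_const_mul,
    prodExpect_const_mul] at key
  have e1 : 2 * v / e * e = 2 * v := by field_simp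
  change 2 * Real.log (v / e) * v + 2 * v - 2 * v / e * e ≤ _ at key
  rw [e1] at key
  linarith

lemma influence_eq (h1 : ∑ s, μ s = 1) (i : ι) (f : (ι → Ω) → ℝ) :
    influence μ i f =
      prodExpect μ (fun x => f x ^ 2) - prodExpect μ (fun x => partialAvg μ {i} f x ^ 2) :=
  prodExpect_sub_partialAvg_sq h1 {i} f

lemma influence_nonneg (h0 : ∀ s, 0 ≤ μ s) (i : ι) (f : (ι → Ω) → ℝ) : 0 ≤ influence μ i f :=
  prodExpect_nonneg h0 fun _ => sq_nonneg _

lemma prodExpect_abs_sub_partialAvg (h0 : ∀ s, 0 ≤ μ s) (h1 : ∑ s, μ s = 1) (i : ι)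
    {f : (ι → Ω) → ℝ} (hf : ∀ x, f x = 0 ∨ f x = 1) :
    prodExpect μ (fun x => |f x - partialAvg μ {i} f x|) = 2 * influence μ i f := by
  have hp0 : ∀ x, 0 ≤ partialAvg μ {i} f x :=
    partialAvg_nonneg h0 _ fun x => by rcases hf x with h | h <;> simp [h]
  have hp1 : ∀ x, partialAvg μ {i} f x ≤ 1 := fun x => by
    have := partialAvg_mono h0 {i} (f := f) (g := fun _ => 1)
      (fun x => by rcases hf x with h | h <;> simp [h]) x
    rwa [partialAvg_eq_prodExpect (f := fun _ => 1), prodExpect_const h1] at this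
  have h := prodExpect_mul_indepOf h1 (indepOf_partialAvg (μ := μ) {i} f) f
  have e1 : (fun x => |f x - partialAvg μ {i} f x|) = fun x =>
      f x - 2 * (f x * partialAvg μ {i} f x) + partialAvg μ {i} f x := by
    funext x
    rcases hf x with hx | hx <;> rw [hx]
    · rw [abs_of_nonpos (by linarith [hp0 x])]; ring
    · rw [abs_of_nonneg (by linarith [hp1 x])]; ring
  have e2 : (fun x => f x ^ 2) = f := by
    funext x
    rcases hf x with hx | hx <;> rw [hx] <;> norm_num
  rw [influence_eq h1, e1, prodExpect_add, prodExpect_sub, prodExpect_const_mul, ← h, e2]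
  have e3 : prodExpect μ (fun x => partialAvg μ {i} f x) = prodExpect μ f :=
    prodExpect_partialAvg h1 {i} f
  simp only [← pow_two]
  rw [e3]
  change prodExpect μ f - _ + _ = _
  ring

/-- The martingale difference obtained by averaging over `S` and then over `i`. -/
def avgDiff (μ : Ω → ℝ) (S : Finset ι) (i : ι) (f : (ι → Ω) → ℝ) (x : ι → Ω) : ℝ :=
  partialAvg μ S f x - partialAvg μ {i} (partialAvg μ S f) x

lemma avgDiff_eq (h1 : ∑ s, μ s = 1) (S : Finset ι) (i : ι) (f : (ι → Ω) → ℝ) :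
    avgDiff μ S i f = partialAvg μ S (fun x => f x - partialAvg μ {i} f x) := by
  rw [partialAvg_sub, partialAvg_comm h1 S {i}]
  rfl

lemma prodExpect_avgDiff_sq (h1 : ∑ s, μ s = 1) (S : Finset ι) (i : ι) (f : (ι → Ω) → ℝ) :
    prodExpect μ (fun x => avgDiff μ S i f x ^ 2) =
      prodExpect μ (fun x => partialAvg μ S f x ^ 2) -
      prodExpect μ (fun x => partialAvg μ (insert i S) f x ^ 2) := by
  rw [Finset.insert_eq, ← partialAvg_partialAvg h1]
  exact prodExpect_sub_partialAvg_sq h1 {i} (partialAvg μ S f)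

lemma prodExpect_avgDiff_sq_le (h0 : ∀ s, 0 ≤ μ s) (h1 : ∑ s, μ s = 1) (S : Finset ι) (i : ι)
    (f : (ι → Ω) → ℝ) :
    prodExpect μ (fun x => avgDiff μ S i f x ^ 2) ≤ influence μ i f := by
  rw [avgDiff_eq h1]
  exact prodExpect_partialAvg_sq_le h0 h1 S _

lemma influence_avgDiff (h1 : ∑ s, μ s = 1) (S : Finset ι) (i j : ι) (f : (ι → Ω) → ℝ) :
    influence μ j (avgDiff μ S i f) =
      prodExpect μ (fun x => partialAvg μ S (fun y => f y - partialAvg μ {j} f y) x ^ 2) -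
      prodExpect μ
        (fun x => partialAvg μ (insert i S) (fun y => f y - partialAvg μ {j} f y) x ^ 2) := by
  rw [← prodExpect_avgDiff_sq h1, influence]
  congr 1
  funext x
  congr 1
  have e : partialAvg μ {j} (avgDiff μ S i f) = avgDiff μ S i (partialAvg μ {j} f) := by
    rw [avgDiff_eq h1, avgDiff_eq h1, partialAvg_comm h1 {j} S, partialAvg_sub,
      partialAvg_comm h1 {j} {i}]
  rw [e]
  simp only [avgDiff, partialAvg_sub]
  ring

lemma prodExpect_sq_sub_partialAvg_le (h0 : ∀ s, 0 ≤ μ s) (h1 : ∑ s, μ s = 1)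
    (S : Finset ι) (f : (ι → Ω) → ℝ) :
    prodExpect μ (fun x => f x ^ 2) - prodExpect μ (fun x => partialAvg μ S f x ^ 2) ≤
      ∑ i ∈ S, influence μ i f := by
  induction S using Finset.induction_on with
  | empty => rw [partialAvg_empty h1]; simp
  | insert i S hi ih =>
    rw [Finset.sum_insert hi]
    have e1 := prodExpect_avgDiff_sq h1 S i f
    have e2 := prodExpect_avgDiff_sq_le h0 h1 S i f
    linarith

lemma prodExpect_avgDiff_sq_le_of_influence_le {l : ℝ} (hl : 0 < l) (hμ : ∀ s, l ≤ μ s)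
    (h1 : ∑ s, μ s = 1) {f : (ι → Ω) → ℝ} (hf : ∀ x, f x = 0 ∨ f x = 1) {M κ : ℝ}
    (hM : 0 < M) (hκ : 0 < κ) (S : Finset ι) (i : ι)
    (hi : influence μ i f ≤ κ / 4 * Real.exp (-(2 * (1 / l + 1) / M))) :
    prodExpect μ (fun x => avgDiff μ S i f x ^ 2) ≤
      M * ∑ j, influence μ j (avgDiff μ S i f) + κ * influence μ i f := by
  have h0 : ∀ s, 0 ≤ μ s := fun s => hl.le.trans (hμ s)
  set I := influence μ i f with hI
  have hI0 : 0 ≤ I := influence_nonneg h0 i f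
  set d := avgDiff μ S i f with hd
  have hQ : 0 ≤ ∑ j, influence μ j d := Finset.sum_nonneg fun j _ => influence_nonneg h0 j d
  set v := prodExpect μ (fun x => d x ^ 2) with hv
  by_cases hvI : v ≤ κ * I
  · have := mul_nonneg hM.le hQ
    linarith
  push Not at hvI
  have hvpos : 0 < v := lt_of_le_of_lt (by positivity) hvI
  have hvle : v ≤ I := prodExpect_avgDiff_sq_le h0 h1 S i f
  have hIpos : 0 < I := hvpos.trans_le hvle
  set e := prodExpect μ (fun x => |d x|) with he
  have hele : e ≤ 2 * I := by
    rw [hI, ← prodExpect_abs_sub_partialAvg h0 h1 i hf,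
      ← prodExpect_partialAvg h1 S (fun x => |f x - partialAvg μ {i} f x|)]
    refine prodExpect_mono h0 fun x => ?_
    rw [hd, avgDiff_eq h1]
    exact abs_partialAvg_le h0 S _ x
  have hepos : 0 < e := by
    refine lt_of_le_of_ne (prodExpect_nonneg h0 fun x => abs_nonneg _) fun h => ?_
    have hz : ∀ x, d x = 0 := by
      intro x
      have hw : 0 < prodWeight μ x := Finset.prod_pos fun i _ => hl.trans_le (hμ _)
      have := (Finset.sum_eq_zero_iff_of_nonneg
        (fun x _ => mul_nonneg (prodWeight_nonneg h0 x) (abs_nonneg (d x)))).mp h.symm x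
          (Finset.mem_univ x)
      simpa [hw.ne'] using this
    have : v = 0 := by simp [hv, hz, prodExpect]
    exact hvpos.ne' this
  have hEnt := entropy_sq_le hl hμ h1 d
  have hlow := two_mul_log_div_le_entropy h0 d hvpos hepos
  set C := 2 * (1 / l + 1)
  have hlog : C / M ≤ 2 * Real.log (v / e) - Real.log v := by
    have h3 : 2 * Real.log (v / e) - Real.log v = Real.log (v / e ^ 2) := by
      rw [Real.log_div hvpos.ne' hepos.ne', Real.log_div hvpos.ne' (by positivity),
        Real.log_pow]
      push_cast; ring
    rw [h3, Real.le_log_iff_exp_le (by positivity), le_div_iff₀ (by positivity)]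
    have h4 : Real.exp (C / M) * I ≤ κ / 4 := by
      calc Real.exp (C / M) * I ≤ Real.exp (C / M) * (κ / 4 * Real.exp (-(C / M))) :=
            mul_le_mul_of_nonneg_left hi (Real.exp_pos _).le
        _ = κ / 4 * (Real.exp (C / M) * Real.exp (-(C / M))) := by ring
        _ = κ / 4 := by rw [← Real.exp_add]; simp
    calc Real.exp (C / M) * e ^ 2 ≤ Real.exp (C / M) * (2 * I) ^ 2 := by
          gcongr
      _ = 4 * (Real.exp (C / M) * I) * I := by ring
      _ ≤ 4 * (κ / 4) * I := by gcongr
      _ ≤ v := by linarith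
  have h5 : v * (C / M) ≤ C * ∑ j, influence μ j d := by
    calc v * (C / M) ≤ v * (2 * Real.log (v / e) - Real.log v) := by gcongr
      _ ≤ _ := by
        change 2 * v * Real.log (v / e) ≤ _ at hlow
        change _ - v * Real.log v ≤ _ at hEnt
        linarith
  have hC : 0 < C := by positivity
  have h6 : v ≤ M * ∑ j, influence μ j d := by
    have : C * v ≤ C * (M * ∑ j, influence μ j d) := by
      calc C * v = M * (v * (C / M)) := by field_simp
        _ ≤ M * (C * ∑ j, influence μ j d) := by gcongr
        _ = _ := by ring
    exact le_of_mul_le_mul_left this hC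
  have : 0 ≤ κ * I := by positivity
  linarith

/-- Friedgut's junta theorem, in variance form, for finite product spaces. -/
lemma prodExpect_sq_sub_partialAvg_le_of_influence_le {l : ℝ} (hl : 0 < l)
    (hμ : ∀ s, l ≤ μ s) (h1 : ∑ s, μ s = 1) {f : (ι → Ω) → ℝ}
    (hf : ∀ x, f x = 0 ∨ f x = 1) {M : ℝ} (hM : 0 < M) (S : Finset ι)
    (hS : ∀ i ∈ S, influence μ i f ≤ M / 4 * Real.exp (-(2 * (1 / l + 1) / M))) :
    prodExpect μ (fun x => f x ^ 2) - prodExpect μ (fun x => partialAvg μ S f x ^ 2) ≤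
      2 * M * ∑ i, influence μ i f := by
  have h0 : ∀ s, 0 ≤ μ s := fun s => hl.le.trans (hμ s)
  have key : ∀ R : Finset ι, R ⊆ S →
      prodExpect μ (fun x => f x ^ 2) - prodExpect μ (fun x => partialAvg μ R f x ^ 2) ≤
      M * ∑ j, (influence μ j f -
        prodExpect μ (fun x => partialAvg μ R (fun y => f y - partialAvg μ {j} f y) x ^ 2)) +
      M * ∑ i ∈ R, influence μ i f := by
    intro R
    induction R using Finset.induction_on with
    | empty =>
      intro _
      simp only [partialAvg_empty h1]
      simp [influence]
    | insert i R hi ih =>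
      intro hR
      have h2 := ih fun j hj => hR (Finset.mem_insert_of_mem hj)
      have h3 := prodExpect_avgDiff_sq h1 R i f
      have h4 := prodExpect_avgDiff_sq_le_of_influence_le hl hμ h1 hf hM hM R i
        (hS i (hR (Finset.mem_insert_self i R)))
      simp only [influence_avgDiff h1] at h4
      rw [Finset.sum_insert hi]
      rw [Finset.sum_sub_distrib] at h2 h4 ⊢
      linarith
  have h2 := key S subset_rfl
  have h3 : ∑ j, (influence μ j f -
        prodExpect μ (fun x => partialAvg μ S (fun y => f y - partialAvg μ {j} f y) x ^ 2)) ≤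
      ∑ j, influence μ j f := by
    refine Finset.sum_le_sum fun j _ => sub_le_self _ ?_
    exact prodExpect_nonneg h0 fun _ => sq_nonneg _
  have h4 : ∑ i ∈ S, influence μ i f ≤ ∑ i, influence μ i f :=
    Finset.sum_le_sum_of_subset_of_nonneg (Finset.subset_univ S)
      fun i _ _ => influence_nonneg h0 i f
  have h5 := mul_le_mul_of_nonneg_left h3 hM.le
  have h6 := mul_le_mul_of_nonneg_left h4 hM.le
  linarith

lemma card_mul_le_sum_influence (h0 : ∀ s, 0 ≤ μ s) (f : (ι → Ω) → ℝ) (t : ℝ) :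
    ((univ.filter fun i => t ≤ influence μ i f).card : ℝ) * t ≤ ∑ i, influence μ i f := by
  rw [← nsmul_eq_mul]
  refine (Finset.card_nsmul_le_sum _ (fun i => influence μ i f) t (by simp)).trans ?_
  exact Finset.sum_le_sum_of_subset_of_nonneg (Finset.subset_univ _)
    fun i _ _ => influence_nonneg h0 i f

lemma sq_partialAvg_compl_sub_le {l : ℝ} (hl : 0 < l) (hμ : ∀ s, l ≤ μ s)
    (h1 : ∑ s, μ s = 1) (f : (ι → Ω) → ℝ) {J T : Finset ι} (hJT : Disjoint T J)
    (x : ι → Ω) :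
    l ^ (J ∪ T).card * (partialAvg μ (J ∪ T)ᶜ f x - partialAvg μ Jᶜ f x) ^ 2 ≤
      ∑ i ∈ T, influence μ i f := by
  have h0 : ∀ s, 0 ≤ μ s := fun s => hl.le.trans (hμ s)
  set R := (J ∪ T)ᶜ with hR
  have hRT : R ∪ T = Jᶜ := by
    ext i
    have : i ∈ T → i ∉ J := fun h h' => Finset.disjoint_left.mp hJT h h'
    simp only [hR, Finset.mem_union, Finset.mem_compl]
    tauto
  have hg : ∀ y, partialAvg μ R f y - partialAvg μ Jᶜ f y =
      partialAvg μ R (fun z => f z - partialAvg μ T f z) y := by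
    intro y
    rw [partialAvg_sub, partialAvg_partialAvg h1, hRT]
  simp only [hg]
  set φ := partialAvg μ R (fun z => f z - partialAvg μ T f z)
  have hinv : partialAvg μ R (fun y => φ y ^ 2) = fun y => φ y ^ 2 := by
    funext y
    have : ∀ z, φ (R.piecewise z y) = φ y := fun z => indepOf_partialAvg R _ y z
    rw [partialAvg_eq_prodExpect]
    simp only [this, prodExpect_const h1]
  have h2 := pow_card_mul_le_partialAvg hl.le hμ h1 (J ∪ T) (f := fun y => φ y ^ 2)
    (fun y => sq_nonneg _) x
  rw [← hinv, partialAvg_partialAvg h1, hR, Finset.union_compl, partialAvg_univ] at h2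
  refine h2.trans ((prodExpect_partialAvg_sq_le h0 h1 R _).trans ?_)
  rw [prodExpect_sub_partialAvg_sq h1]
  exact prodExpect_sq_sub_partialAvg_le h0 h1 T f

end ProductSpace

/-- A dense Boolean function of bounded total influence has a core `J` of bounded size and an
assignment `σ` of `J` on which its conditional density is close to `1`, even after additionally
fixing any bounded number of coordinates outside a bounded set `Λ ⊇ J`. -/
lemma exists_core {l K δ ε : ℝ} (hl : 0 < l) (hl1 : l ≤ 1) (hK : 0 < K) (hδ : 0 < δ)
    (hε : 0 < ε) (r : ℕ) : ∃ B₁ B₂ : ℕ, ∀ (ι Ω : Type) [Fintype ι] [DecidableEq ι] [Fintype Ω]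
    (μ : Ω → ℝ), (∀ s, l ≤ μ s) → ∑ s, μ s = 1 → ∀ f : (ι → Ω) → ℝ,
    (∀ x, f x = 0 ∨ f x = 1) → ∑ i, influence μ i f ≤ K → δ ≤ prodExpect μ f →
    ∃ (J Λ : Finset ι) (σ : ι → Ω), J ⊆ Λ ∧ J.card ≤ B₁ ∧ Λ.card ≤ B₂ ∧
      ∀ T : Finset ι, Disjoint T Λ → T.card ≤ r * B₁ → ∀ θ : ι → Ω, (∀ i ∈ J, θ i = σ i) →
        1 - ε ≤ partialAvg μ (J ∪ T)ᶜ f θ := by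
  set M := δ * ε / (8 * K) with hM
  have hMpos : 0 < M := by positivity
  set t₁ := M / 4 * Real.exp (-(2 * (1 / l + 1) / M)) with ht₁
  have ht₁pos : 0 < t₁ := by positivity
  set B₁ := ⌈K / t₁⌉₊
  set t₂ := min t₁ (l ^ (B₁ + r * B₁) * (ε / 2) ^ 2 / (r * B₁ + 1)) with ht₂
  have ht₂pos : 0 < t₂ := lt_min ht₁pos (by positivity)
  refine ⟨B₁, ⌈K / t₂⌉₊, ?_⟩
  intro ι Ω _ _ _ μ hμ h1 f hf hfK hfδ
  have h0 : ∀ s, 0 ≤ μ s := fun s => hl.le.trans (hμ s)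
  have hcard : ∀ t : ℝ, 0 < t → (univ.filter fun i => t ≤ influence μ i f).card ≤ ⌈K / t⌉₊ := by
    intro t ht
    have h2 : ((univ.filter fun i => t ≤ influence μ i f).card : ℝ) ≤ K / t := by
      rw [le_div_iff₀ ht]
      exact (card_mul_le_sum_influence h0 f t).trans hfK
    exact_mod_cast h2.trans (Nat.le_ceil _)
  set J := univ.filter fun i => t₁ ≤ influence μ i f with hJ
  set Λ := univ.filter fun i => t₂ ≤ influence μ i f with hΛ
  have hJΛ : J ⊆ Λ := by
    intro i hi
    simp only [hJ, hΛ, Finset.mem_filter, Finset.mem_univ, true_and] at hi ⊢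
    exact (min_le_left _ _).trans hi
  set g := partialAvg μ Jᶜ f with hg
  have hvar := prodExpect_sq_sub_partialAvg_le_of_influence_le hl hμ h1 hf hMpos Jᶜ (by
    intro i hi
    simp only [hJ, Finset.mem_compl, Finset.mem_filter, Finset.mem_univ, true_and, not_le] at hi
    exact hi.le)
  have hff : (fun x => f x ^ 2) = f := by
    funext x
    rcases hf x with hx | hx <;> rw [hx] <;> norm_num
  have hEg : prodExpect μ g = prodExpect μ f := prodExpect_partialAvg h1 Jᶜ f
  have hg0 : ∀ x, 0 ≤ g x :=
    partialAvg_nonneg h0 _ fun x => by rcases hf x with h | h <;> simp [h]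
  obtain ⟨σ, hσ⟩ : ∃ σ, 1 - ε / 2 ≤ g σ := by
    by_contra hcon
    push Not at hcon
    have h2 : prodExpect μ (fun x => ε / 2 * g x) ≤ prodExpect μ (fun x => g x - g x ^ 2) := by
      refine prodExpect_mono h0 fun x => ?_
      have h3 := hcon x
      have h4 := hg0 x
      nlinarith
    rw [prodExpect_const_mul, prodExpect_sub] at h2
    change _ ≤ prodExpect μ g - _ at h2
    rw [hEg] at h2
    rw [hff] at hvar
    have h5 : 2 * M * ∑ i, influence μ i f ≤ δ * ε / 4 := by
      calc 2 * M * ∑ i, influence μ i f ≤ 2 * M * K := by gcongr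
        _ = δ * ε / 4 := by rw [hM]; field_simp; ring
    have h6 : ε / 2 * δ ≤ ε / 2 * prodExpect μ f := by gcongr
    have h7 : 0 < δ * ε := by positivity
    linarith
  refine ⟨J, Λ, σ, hJΛ, hcard t₁ ht₁pos, hcard t₂ ht₂pos, ?_⟩
  intro T hT hTc θ hθ
  have hTJ : Disjoint T J := hT.mono_right hJΛ
  have h2 := sq_partialAvg_compl_sub_le hl hμ h1 f hTJ θ
  have h3 : ∑ i ∈ T, influence μ i f ≤ T.card * t₂ := by
    rw [← nsmul_eq_mul]
    refine Finset.sum_le_card_nsmul _ _ _ fun i hi => ?_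
    have := Finset.disjoint_left.mp hT hi
    simp only [hΛ, Finset.mem_filter, Finset.mem_univ, true_and, not_le] at this
    exact this.le
  have hTr : (T.card : ℝ) ≤ r * B₁ := by exact_mod_cast hTc
  have h4 : (T.card : ℝ) * t₂ ≤ l ^ (B₁ + r * B₁) * (ε / 2) ^ 2 := by
    calc (T.card : ℝ) * t₂ ≤
        (r * B₁ + 1) * (l ^ (B₁ + r * B₁) * (ε / 2) ^ 2 / (r * B₁ + 1)) := by
          refine mul_le_mul (by linarith) (min_le_right _ _) ht₂pos.le (by positivity)
      _ = _ := by field_simp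
  have h5 : l ^ (B₁ + r * B₁) ≤ l ^ (J ∪ T).card := by
    refine pow_le_pow_of_le_one hl.le hl1 ?_
    have := Finset.card_union_le J T
    have hJc : J.card ≤ B₁ := hcard t₁ ht₁pos
    omega
  have hpow : 0 < l ^ (B₁ + r * B₁) := by positivity
  have h6 : (partialAvg μ (J ∪ T)ᶜ f θ - g θ) ^ 2 ≤ (ε / 2) ^ 2 := by
    refine le_of_mul_le_mul_left ?_ hpow
    calc l ^ (B₁ + r * B₁) * (partialAvg μ (J ∪ T)ᶜ f θ - g θ) ^ 2
        ≤ l ^ (J ∪ T).card * (partialAvg μ (J ∪ T)ᶜ f θ - g θ) ^ 2 := by gcongr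
      _ ≤ _ := h2.trans (h3.trans h4)
  have h7 := (abs_le_of_sq_le_sq' h6 (by positivity)).1
  have h8 : g θ = g σ := by
    have e : θ = Jᶜ.piecewise θ σ := by
      ext i
      by_cases hi : i ∈ J <;> simp [hi, hθ]
    rw [e]
    exact indepOf_partialAvg Jᶜ f σ θ
  linarith

section Russo

variable {ι Ω : Type} [Fintype ι] [DecidableEq ι] [Fintype Ω]

lemma sum_prod_erase_mul_eq_prodExpect {μ : Ω → ℝ} (h1 : ∑ s, μ s = 1) (ν : Ω → ℝ) (i : ι)
    (f : (ι → Ω) → ℝ) :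
    ∑ x : ι → Ω, (∏ j ∈ univ.erase i, μ (x j)) * ν (x i) * f x =
      prodExpect μ (fun x => ∑ s, ν s * f (Function.update x i s)) := by
  have key : ∑ p : (ι → Ω) × Ω, (∏ j ∈ univ.erase i, μ (p.1 j)) * μ (p.1 i) *
        (ν p.2 * f (Function.update p.1 i p.2)) =
      ∑ p : (ι → Ω) × Ω, μ p.2 * ((∏ j ∈ univ.erase i, μ (p.1 j)) * ν (p.1 i) * f p.1) := by
    refine Fintype.sum_bijective (fun p => (Function.update p.1 i p.2, p.1 i)) ?_ _ _ ?_
    · refine Function.Involutive.bijective fun p => ?_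
      simp
    · rintro ⟨x, s⟩
      have : ∏ j ∈ univ.erase i, μ (Function.update x i s j) = ∏ j ∈ univ.erase i, μ (x j) :=
        Finset.prod_congr rfl fun j hj => by
          rw [Function.update_of_ne (Finset.ne_of_mem_erase hj)]
      simp only [this, Function.update_self]
      ring
  rw [Fintype.sum_prod_type, Fintype.sum_prod_type] at key
  simp only [← Finset.sum_mul, h1, one_mul] at key
  rw [← key]
  refine Finset.sum_congr rfl fun x _ => ?_
  rw [prodWeight, ← Finset.prod_erase_mul _ _ (Finset.mem_univ i), Finset.mul_sum]

/-- The weights on `Bool × Ω` whose flag is `true` with probability `ρ`, independently of a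
uniform element of `Ω`. -/
noncomputable def flagWeight (Ω : Type) [Fintype Ω] (ρ : ℝ) (s : Bool × Ω) : ℝ :=
  (if s.1 then ρ else 1 - ρ) * (Fintype.card Ω : ℝ)⁻¹

lemma sum_flagWeight [Nonempty Ω] (ρ : ℝ) : ∑ s, flagWeight Ω ρ s = 1 := by
  have h : (Fintype.card Ω : ℝ) ≠ 0 := by exact_mod_cast Fintype.card_ne_zero
  simp [Fintype.sum_prod_type, flagWeight]
  field_simp
  ring

lemma le_flagWeight {ρ : ℝ} (h : 1 / 3 ≤ ρ) (h' : ρ ≤ 2 / 3) (s : Bool × Ω) :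
    1 / (3 * (Fintype.card Ω : ℝ)) ≤ flagWeight Ω ρ s := by
  have e : 1 / (3 * (Fintype.card Ω : ℝ)) = 1 / 3 * (Fintype.card Ω : ℝ)⁻¹ := by
    rw [one_div, mul_inv]; norm_num
  rw [e, flagWeight]
  refine mul_le_mul_of_nonneg_right ?_ (by positivity)
  split_ifs <;> linarith

lemma hasDerivAt_prodExpect_flagWeight [Nonempty Ω] (f : (ι → Bool × Ω) → ℝ) (ρ : ℝ) :
    HasDerivAt (fun ρ => prodExpect (flagWeight Ω ρ) f)
      (∑ i, prodExpect (flagWeight Ω ρ) (fun x => (Fintype.card Ω : ℝ)⁻¹ *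
        ∑ ω, (f (Function.update x i (true, ω)) - f (Function.update x i (false, ω))))) ρ := by
  let ν : Bool × Ω → ℝ := fun s => (if s.1 then 1 else -1) * (Fintype.card Ω : ℝ)⁻¹
  have hd : ∀ s : Bool × Ω, HasDerivAt (fun ρ => flagWeight Ω ρ s) (ν s) ρ := by
    rintro ⟨c, ω⟩
    cases c
    · simpa [flagWeight, ν] using
        ((hasDerivAt_id ρ).const_sub 1).mul_const (Fintype.card Ω : ℝ)⁻¹
    · simpa [flagWeight, ν] using (hasDerivAt_id ρ).mul_const (Fintype.card Ω : ℝ)⁻¹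
  have h := HasDerivAt.fun_sum (u := univ) fun (x : ι → Bool × Ω) _ =>
    (HasDerivAt.fun_finsetProd (u := univ) fun (i : ι) _ => hd (x i)).mul_const (f x)
  refine h.congr_deriv ?_
  simp only [smul_eq_mul, Finset.sum_mul]
  rw [Finset.sum_comm]
  refine Finset.sum_congr rfl fun i _ => ?_
  rw [sum_prod_erase_mul_eq_prodExpect (sum_flagWeight ρ) ν i f]
  congr 1
  funext x
  rw [Fintype.sum_prod_type, Fintype.sum_bool, Finset.mul_sum, ← Finset.sum_add_distrib]
  refine Finset.sum_congr rfl fun ω _ => ?_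
  simp [ν]
  ring

lemma influence_le_mul_prodExpect_pivotal {μ : Bool × Ω → ℝ} (h0 : ∀ s, 0 ≤ μ s)
    (h1 : ∑ s, μ s = 1) {f : (ι → Bool × Ω) → ℝ}
    (hf : ∀ x, f x = 0 ∨ f x = 1) (i : ι)
    (hmono : ∀ x ω, f (Function.update x i (false, ω)) ≤ f (Function.update x i (true, ω)))
    (hconn : ∀ x, (∀ ω, f (Function.update x i (false, ω)) = f (Function.update x i (true, ω))) →
      ∀ s t, f (Function.update x i s) = f (Function.update x i t)) :
    influence μ i f ≤ prodExpect μ (fun x =>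
        ∑ ω, (f (Function.update x i (true, ω)) - f (Function.update x i (false, ω)))) := by
  have hff : (fun x => f x ^ 2) = f := by
    funext x
    rcases hf x with hx | hx <;> rw [hx] <;> norm_num
  rw [influence_eq h1, hff, ← prodExpect_partialAvg h1 {i} f, ← prodExpect_sub]
  refine prodExpect_mono h0 fun x => ?_
  set p := partialAvg μ {i} f x with hp
  have hnn : ∀ ω ∈ univ,
      0 ≤ f (Function.update x i (true, ω)) - f (Function.update x i (false, ω)) :=
    fun ω _ => sub_nonneg.mpr (hmono x ω)
  by_cases hc : ∀ ω, f (Function.update x i (false, ω)) = f (Function.update x i (true, ω))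
  · have hpf : p = f x := by
      rw [hp, partialAvg_eq_prodExpect, ← prodExpect_const (ι := ι) h1 (f x)]
      congr 1
      funext y
      rw [Finset.piecewise_singleton, hconn x hc (y i) (x i), Function.update_eq_self]
    have : p - p ^ 2 = 0 := by
      rw [hpf]; rcases hf x with hx | hx <;> rw [hx] <;> norm_num
    rw [this]
    exact Finset.sum_nonneg hnn
  · push Not at hc
    obtain ⟨ω, hω⟩ := hc
    have h2 := Finset.single_le_sum hnn (Finset.mem_univ ω)
    have h3 : f (Function.update x i (true, ω)) - f (Function.update x i (false, ω)) = 1 := by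
      have hm := hmono x ω
      rcases hf (Function.update x i (true, ω)) with a | a <;>
        rcases hf (Function.update x i (false, ω)) with b | b
      · exact absurd (b.trans a.symm) hω
      · linarith
      · linarith
      · exact absurd (b.trans a.symm) hω
    have h4 : p - p ^ 2 ≤ 1 := by nlinarith [sq_nonneg (p - 1 / 2)]
    linarith

/-- A Russo-type argument: at some `ρ` in `[1/3, 2/3]` the total influence is bounded. -/
lemma exists_sum_influence_flagWeight_le [Nonempty Ω] {f : (ι → Bool × Ω) → ℝ}
    (hf : ∀ x, f x = 0 ∨ f x = 1)
    (hmono : ∀ x i ω, f (Function.update x i (false, ω)) ≤ f (Function.update x i (true, ω)))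
    (hconn : ∀ x i,
      (∀ ω, f (Function.update x i (false, ω)) = f (Function.update x i (true, ω))) →
      ∀ s t, f (Function.update x i s) = f (Function.update x i t)) :
    ∃ ρ : ℝ, 1 / 3 ≤ ρ ∧ ρ ≤ 2 / 3 ∧
      ∑ i, influence (flagWeight Ω ρ) i f ≤ 3 * Fintype.card Ω := by
  obtain ⟨ρ, ⟨hρ1, hρ2⟩, hρ⟩ := exists_hasDerivAt_eq_slope
    (fun ρ => prodExpect (flagWeight Ω ρ) f) _ (a := 1 / 3) (b := 2 / 3) (by norm_num)
    (fun ρ _ => (hasDerivAt_prodExpect_flagWeight f ρ).continuousAt.continuousWithinAt)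
    (fun ρ _ => hasDerivAt_prodExpect_flagWeight f ρ)
  refine ⟨ρ, hρ1.le, hρ2.le, ?_⟩
  have hN : 0 < (Fintype.card Ω : ℝ) := by exact_mod_cast Fintype.card_pos
  have hpos : ∀ ρ : ℝ, 1 / 3 ≤ ρ → ρ ≤ 2 / 3 → ∀ s, 0 ≤ flagWeight Ω ρ s := fun ρ h h' s =>
    le_trans (by positivity) (le_flagWeight h h' s)
  have hle : prodExpect (flagWeight Ω (2 / 3)) f ≤ 1 := by
    rw [← prodExpect_const (ι := ι) (sum_flagWeight (Ω := Ω) (2 / 3)) 1]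
    exact prodExpect_mono (hpos _ (by norm_num) le_rfl)
      fun x => by rcases hf x with h | h <;> simp [h]
  have hge : 0 ≤ prodExpect (flagWeight Ω (1 / 3)) f :=
    prodExpect_nonneg (hpos _ le_rfl (by norm_num))
      fun x => by rcases hf x with h | h <;> simp [h]
  have hslope : (prodExpect (flagWeight Ω (2 / 3)) f - prodExpect (flagWeight Ω (1 / 3)) f) /
      (2 / 3 - 1 / 3) ≤ 3 := by
    rw [div_le_iff₀ (by norm_num)]; linarith
  rw [← hρ] at hslope
  simp only [prodExpect_const_mul, ← Finset.mul_sum] at hslope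
  have h2 : ∑ i, influence (flagWeight Ω ρ) i f ≤ ∑ i, prodExpect (flagWeight Ω ρ) (fun x =>
      ∑ ω, (f (Function.update x i (true, ω)) - f (Function.update x i (false, ω)))) :=
    Finset.sum_le_sum fun i _ => influence_le_mul_prodExpect_pivotal (hpos ρ hρ1.le hρ2.le)
      (sum_flagWeight ρ) hf i (fun x => hmono x i) (fun x => hconn x i)
  refine h2.trans ?_
  rwa [inv_mul_le_iff₀ hN, mul_comm] at hslope

lemma prodExpect_flagWeight_snd (ρ : ℝ) (φ : (ι → Ω) → ℝ) :
    prodExpect (flagWeight Ω ρ) (fun x => φ fun i => (x i).2) =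
      ((Fintype.card Ω : ℝ) ^ Fintype.card ι)⁻¹ * ∑ z, φ z := by
  let w : Bool → ℝ := fun b => if b then ρ else 1 - ρ
  have h : prodExpect (flagWeight Ω ρ) (fun x => φ fun i => (x i).2) =
      ∑ p : (ι → Bool) × (ι → Ω), (∏ i, w (p.1 i)) *
        (((Fintype.card Ω : ℝ) ^ Fintype.card ι)⁻¹ * φ p.2) := by
    refine Fintype.sum_equiv (Equiv.arrowProdEquivProdArrow ι (fun _ => Bool) (fun _ => Ω))
      _ _ fun x => ?_
    simp only [prodWeight, flagWeight, Finset.prod_mul_distrib, Finset.prod_const,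
      Equiv.arrowProdEquivProdArrow, Equiv.coe_fn_mk, Finset.card_univ, inv_pow]
    exact mul_assoc _ _ _
  have h2 : ∑ c : ι → Bool, ∏ i, w (c i) = 1 := by
    rw [← Fintype.prod_sum (fun (_ : ι) (b : Bool) => w b)]
    simp [w]
  rw [h, Fintype.sum_prod_type]
  simp only [← Finset.mul_sum, ← Finset.sum_mul]
  rw [h2, one_mul]

end Russo

section Hit

variable {ι S : Type}

/-- The pair `(u, v)` is compatible with the symbol `(c, s, b, b')`: both entries agree if the
flag `c` is `false`, and the entry on the side `s` agrees if the flag is `true`. -/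
def Compat (s : Bool × Bool × S × S) (u v : S) : Prop :=
  (u = s.2.2.1 ∨ (s.1 = true ∧ s.2.1 = false)) ∧ (v = s.2.2.2 ∨ (s.1 = true ∧ s.2.1 = true))

/-- Some point of `P` is compatible with `x` in every coordinate. -/
def Covered (P : Finset (ι ⊕ ι → S)) (x : ι → Bool × Bool × S × S) : Prop :=
  ∃ p ∈ P, ∀ i, Compat (x i) (p (Sum.inl i)) (p (Sum.inr i))

/-- Some point of `P` agrees with `z` on the prescribed side of every coordinate. -/
def Hit (P : Finset (ι ⊕ ι → S)) (z : ι → Bool × S × S) : Prop :=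
  ∃ p ∈ P, ∀ i, if (z i).1 then p (Sum.inl i) = (z i).2.1 else p (Sum.inr i) = (z i).2.2

lemma Covered.mono {P : Finset (ι ⊕ ι → S)} {x y : ι → Bool × Bool × S × S}
    (h : ∀ i u v, Compat (x i) u v → Compat (y i) u v) (hx : Covered P x) : Covered P y := by
  obtain ⟨p, hp, hpx⟩ := hx
  exact ⟨p, hp, fun i => h i _ _ (hpx i)⟩

lemma covered_update_mono [DecidableEq ι] {P : Finset (ι ⊕ ι → S)}
    (x : ι → Bool × Bool × S × S) (i : ι) {s t : Bool × Bool × S × S}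
    (h : ∀ u v, Compat s u v → Compat t u v) (hs : Covered P (Function.update x i s)) :
    Covered P (Function.update x i t) := by
  refine hs.mono fun j u v hj => ?_
  by_cases hji : j = i
  · subst hji
    simp only [Function.update_self] at hj ⊢
    exact h u v hj
  · simpa only [Function.update_of_ne hji] using hj

lemma Covered.hit {P : Finset (ι ⊕ ι → S)} {x : ι → Bool × Bool × S × S} (hx : Covered P x) :
    Hit P fun i => (x i).2 := by
  obtain ⟨p, hp, hpx⟩ := hx
  refine ⟨p, hp, fun i => ?_⟩
  have h := hpx i
  unfold Compat at h
  split_ifs with hi <;> simp_all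

lemma covered_update_iff [DecidableEq ι] {P : Finset (ι ⊕ ι → S)}
    {x : ι → Bool × Bool × S × S} {i : ι}
    (h : ∀ ω, Covered P (Function.update x i (false, ω)) ↔
      Covered P (Function.update x i (true, ω))) (s t : Bool × Bool × S × S) :
    Covered P (Function.update x i s) ↔ Covered P (Function.update x i t) := by
  have e : ∀ s t : Bool × Bool × S × S, (∀ u v, Compat s u v ↔ Compat t u v) →
      (Covered P (Function.update x i s) ↔ Covered P (Function.update x i t)) := fun s t hst =>
    ⟨covered_update_mono x i fun u v => (hst u v).1, covered_update_mono x i fun u v => (hst u v).2⟩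
  have h1 : ∀ d b b', Covered P (Function.update x i (false, d, b, b')) ↔
      Covered P (Function.update x i (false, true, b, b')) := fun d b b' =>
    e _ _ fun u v => by simp [Compat]
  have h2 : ∀ b b' c', Covered P (Function.update x i (false, true, b, b')) ↔
      Covered P (Function.update x i (false, true, b, c')) := fun b b' c' => by
    rw [h (true, b, b'), h (true, b, c')]
    exact e _ _ fun u v => by simp [Compat]
  have h3 : ∀ b c b', Covered P (Function.update x i (false, true, b, b')) ↔
      Covered P (Function.update x i (false, true, c, b')) := fun b c b' => by
    rw [← h1 false b b', ← h1 false c b', h (false, b, b'), h (false, c, b')]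
    exact e _ _ fun u v => by simp [Compat]
  have h4 : ∀ s : Bool × Bool × S × S, Covered P (Function.update x i s) ↔
      Covered P (Function.update x i (false, true, t.2.2.1, t.2.2.2)) := by
    rintro ⟨c, d, b, b'⟩
    have : Covered P (Function.update x i (c, d, b, b')) ↔
        Covered P (Function.update x i (false, d, b, b')) := by
      cases c
      · rfl
      · exact (h (d, b, b')).symm
    rw [this, h1, h2 b b' t.2.2.2, h3 b t.2.2.1]
  exact (h4 s).trans (h4 t).symm

lemma sum_snd_mem [Fintype ι] [DecidableEq ι] [Fintype S] [DecidableEq S]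
    (P : Finset (ι ⊕ ι → S)) :
    ∑ z : ι → Bool × S × S,
      (if (Sum.elim (fun i => (z i).2.1) fun i => (z i).2.2) ∈ P then (1 : ℝ) else 0) =
      2 ^ Fintype.card ι * (P.card : ℝ) := by
  let e : (ι → Bool × S × S) ≃ (ι → Bool) × (ι ⊕ ι → S) :=
    (Equiv.arrowProdEquivProdArrow ι (fun _ => Bool) (fun _ => S × S)).trans
      ((Equiv.refl _).prodCongr ((Equiv.arrowProdEquivProdArrow ι (fun _ => S) (fun _ => S)).trans
        (Equiv.sumArrowEquivProdArrow ι ι S).symm))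
  have h : ∑ z : ι → Bool × S × S,
      (if (Sum.elim (fun i => (z i).2.1) fun i => (z i).2.2) ∈ P then (1 : ℝ) else 0) =
      ∑ p : (ι → Bool) × (ι ⊕ ι → S), if p.2 ∈ P then (1 : ℝ) else 0 :=
    Fintype.sum_equiv e _ _ fun z => rfl
  rw [h, Fintype.sum_prod_type]
  simp

open scoped Classical in
/-- The indicator function of `Covered P`. -/
noncomputable def coveredInd (P : Finset (ι ⊕ ι → S)) (x : ι → Bool × Bool × S × S) : ℝ :=
  if Covered P x then 1 else 0

lemma coveredInd_of {P : Finset (ι ⊕ ι → S)} {x : ι → Bool × Bool × S × S} (h : Covered P x) :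
    coveredInd P x = 1 := if_pos h

lemma coveredInd_eq_zero_or_one (P : Finset (ι ⊕ ι → S)) (x : ι → Bool × Bool × S × S) :
    coveredInd P x = 0 ∨ coveredInd P x = 1 := by
  by_cases h : Covered P x <;> simp [coveredInd, h]

lemma coveredInd_eq_iff {P : Finset (ι ⊕ ι → S)} {x y : ι → Bool × Bool × S × S} :
    coveredInd P x = coveredInd P y ↔ (Covered P x ↔ Covered P y) := by
  by_cases h : Covered P x <;> by_cases h' : Covered P y <;> simp [coveredInd, h, h']

lemma coveredInd_le {P : Finset (ι ⊕ ι → S)} {x : ι → Bool × Bool × S × S} {c : ℝ}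
    (h0 : 0 ≤ c) (h : Covered P x → 1 ≤ c) : coveredInd P x ≤ c := by
  by_cases hx : Covered P x
  · simpa [coveredInd, hx] using h hx
  · simpa [coveredInd, hx] using h0

lemma coveredInd_nonneg (P : Finset (ι ⊕ ι → S)) (x : ι → Bool × Bool × S × S) :
    0 ≤ coveredInd P x := by
  rcases coveredInd_eq_zero_or_one P x with h | h <;> simp [h]

lemma exists_sum_influence_coveredInd_le [Fintype ι] [DecidableEq ι] [Fintype S] [Nonempty S]
    (P : Finset (ι ⊕ ι → S)) : ∃ ρ : ℝ, 1 / 3 ≤ ρ ∧ ρ ≤ 2 / 3 ∧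
      ∑ i, influence (flagWeight (Bool × S × S) ρ) i (coveredInd P) ≤
        3 * (Fintype.card (Bool × S × S) : ℝ) := by
  refine exists_sum_influence_flagWeight_le (coveredInd_eq_zero_or_one P)
    (fun x i ω => coveredInd_le (coveredInd_nonneg P _) fun h =>
      (coveredInd_of (covered_update_mono x i (fun u v h => ?_) h)).ge)
    (fun x i h s t => coveredInd_eq_iff.2 (covered_update_iff (fun ω => ?_) s t))
  · simp only [Compat] at h ⊢
    tauto
  · exact coveredInd_eq_iff.1 (h ω)

lemma le_prodExpect_coveredInd [Fintype ι] [DecidableEq ι] [Fintype S] [DecidableEq S]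
    [Nonempty S] {δ : ℝ} {P : Finset (ι ⊕ ι → S)}
    (hP : δ * (Fintype.card S : ℝ) ^ (2 * Fintype.card ι) ≤ P.card) {ρ : ℝ}
    (hρ : ∀ s, 0 ≤ flagWeight (Bool × S × S) ρ s) :
    δ ≤ prodExpect (flagWeight (Bool × S × S) ρ) (coveredInd P) := by
  let φ : (ι → Bool × S × S) → ℝ := fun z =>
    if (Sum.elim (fun i => (z i).2.1) fun i => (z i).2.2) ∈ P then (1 : ℝ) else 0
  have h1 : prodExpect (flagWeight (Bool × S × S) ρ) (fun x => φ fun i => (x i).2) ≤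
      prodExpect (flagWeight (Bool × S × S) ρ) (coveredInd P) := by
    refine prodExpect_mono hρ fun x => ?_
    by_cases h : (Sum.elim (fun i => (x i).2.2.1) fun i => (x i).2.2.2) ∈ P
    · have hc : Covered P x := ⟨_, h, fun i => by simp [Compat]⟩
      simp [φ, h, coveredInd_of hc]
    · simpa [φ, h] using coveredInd_nonneg P x
  refine le_trans ?_ h1
  rw [prodExpect_flagWeight_snd, sum_snd_mem, le_inv_mul_iff₀ (by positivity)]
  simp only [Fintype.card_prod, Fintype.card_bool]
  push_cast
  calc _ = 2 ^ Fintype.card ι * (δ * (Fintype.card S : ℝ) ^ (2 * Fintype.card ι)) := by ring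
    _ ≤ _ := by gcongr

open scoped Classical in
lemma partialAvg_coveredInd_le [Fintype ι] [DecidableEq ι] [Fintype S] [Nonempty S]
    (P : Finset (ι ⊕ ι → S)) {ρ : ℝ} (hρ : ∀ s, 0 ≤ flagWeight (Bool × S × S) ρ s)
    (R : Finset ι) (θ : ι → Bool × Bool × S × S) :
    partialAvg (flagWeight (Bool × S × S) ρ) Rᶜ (coveredInd P) θ ≤
      1 - Nat.card {z : ι → Bool × S × S // ¬ Hit P (R.piecewise (fun i => (θ i).2) z)} /
        (Fintype.card (Bool × S × S) : ℝ) ^ Fintype.card ι := by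
  let φ : (ι → Bool × S × S) → ℝ := fun z =>
    if Hit P (R.piecewise (fun i => (θ i).2) z) then (1 : ℝ) else 0
  have h1 : partialAvg (flagWeight (Bool × S × S) ρ) Rᶜ (coveredInd P) θ ≤
      prodExpect (flagWeight (Bool × S × S) ρ) (fun x => φ fun i => (x i).2) := by
    refine prodExpect_mono hρ fun y => coveredInd_le ?_ fun hy => ?_
    · simp only [φ]
      split_ifs <;> norm_num
    · have h : (fun i => (Rᶜ.piecewise y θ i).2) =
          R.piecewise (fun i => (θ i).2) fun i => (y i).2 := by
        ext1 i
        by_cases hi : i ∈ R <;> simp [Finset.piecewise, hi]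
      have hh := hy.hit
      rw [h] at hh
      simp [φ, hh]
  refine h1.trans_eq ?_
  have hpow : (0 : ℝ) < (Fintype.card (Bool × S × S) : ℝ) ^ Fintype.card ι := by positivity
  have h4 : ∑ z, φ z = (Fintype.card (Bool × S × S) : ℝ) ^ Fintype.card ι -
        Nat.card {z : ι → Bool × S × S // ¬ Hit P (R.piecewise (fun i => (θ i).2) z)} := by
    rw [Nat.card_eq_fintype_card, Fintype.card_subtype, eq_sub_iff_add_eq, Finset.sum_boole]
    have := Finset.card_filter_add_card_filter_not (s := (univ : Finset (ι → Bool × S × S)))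
      (fun z => Hit P (R.piecewise (fun i => (θ i).2) z))
    rw [Finset.card_univ, Fintype.card_fun] at this
    exact_mod_cast this
  rw [prodExpect_flagWeight_snd, h4]
  field_simp

lemma exists_core_hit (S : Type) [Fintype S] [DecidableEq S] [Nonempty S] {k : ℕ} (hk : 0 < k)
    {δ : ℝ} (hδ : 0 < δ) : ∃ B₁ B₂ : ℕ, ∀ (ι : Type) [Fintype ι] [DecidableEq ι]
      (P : Finset (ι ⊕ ι → S)), δ * (Fintype.card S : ℝ) ^ (2 * Fintype.card ι) ≤ P.card →
      ∃ (J Λ : Finset ι) (σ : ι → Bool × S × S), J ⊆ Λ ∧ J.card ≤ B₁ ∧ Λ.card ≤ B₂ ∧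
        ∀ T, Disjoint T Λ → T.card ≤ k * B₁ → ∀ θ : ι → Bool × S × S, (∀ i ∈ J, θ i = σ i) →
          k * Nat.card {z : ι → Bool × S × S // ¬ Hit P ((J ∪ T).piecewise θ z)} <
            Fintype.card (Bool × S × S) ^ Fintype.card ι := by
  have hN : (1 : ℝ) ≤ Fintype.card (Bool × S × S) := by exact_mod_cast Fintype.card_pos
  have hk' : (1 : ℝ) ≤ k := by exact_mod_cast hk
  obtain ⟨B₁, B₂, hB⟩ := exists_core (l := 1 / (3 * (Fintype.card (Bool × S × S) : ℝ)))
    (K := 3 * (Fintype.card (Bool × S × S) : ℝ)) (ε := 1 / (2 * k)) (by positivity)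
    (by rw [div_le_one (by positivity)]; linarith) (by positivity) hδ (by positivity) k
  refine ⟨B₁, B₂, fun ι _ _ P hP => ?_⟩
  obtain ⟨ρ, hρ, hρ', hI⟩ := exists_sum_influence_coveredInd_le P
  have hμ := fun s => le_flagWeight (Ω := Bool × S × S) hρ hρ' s
  have hμ0 : ∀ s, 0 ≤ flagWeight (Bool × S × S) ρ s := fun s => le_trans (by positivity) (hμ s)
  obtain ⟨J, Λ, σ, hJ, hJc, hΛc, h⟩ := hB ι _ _ hμ (sum_flagWeight ρ) _
    (coveredInd_eq_zero_or_one P) hI (le_prodExpect_coveredInd hP hμ0)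
  refine ⟨J, Λ, fun i => (σ i).2, hJ, hJc, hΛc, fun T hT hTc θ hθ => ?_⟩
  have h2 := (h T hT hTc (fun i => ((σ i).1, θ i)) fun i hi => by rw [hθ i hi]).trans
    (partialAvg_coveredInd_le P hμ0 _ _)
  have hpow : (0 : ℝ) < (Fintype.card (Bool × S × S) : ℝ) ^ Fintype.card ι := by positivity
  have h3 := sub_le_sub_iff_left (1 : ℝ) |>.1 h2
  rw [div_le_div_iff₀ hpow (by positivity)] at h3
  have h6 : (k : ℝ) * Nat.card {z : ι → Bool × S × S // ¬ Hit P ((J ∪ T).piecewise θ z)} <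
      (Fintype.card (Bool × S × S) : ℝ) ^ Fintype.card ι := by linarith
  exact_mod_cast h6

end Hit

section Soundness

lemma exists_pairwise_disjoint_or_hitting_set {α β : Type*} [DecidableEq β] (Λ : α → Finset β)
    (p : α → Prop) {B : ℕ} (hB : ∀ v, p v → (Λ v).card ≤ B) (n : ℕ) :
    (∃ w : Fin n → α, (∀ j, p (w j)) ∧ ∀ j l, j ≠ l → Disjoint (Λ (w j)) (Λ (w l))) ∨
      ∃ M : Finset β, M.card ≤ n * B ∧ ∀ v, p v → ¬ Disjoint (Λ v) M := by
  induction n with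
  | zero => exact Or.inl ⟨Fin.elim0, fun j => j.elim0, fun j => j.elim0⟩
  | succ n ih =>
    rcases ih with ⟨w, hw, hd⟩ | ⟨M, hM, h⟩
    · by_cases hv : ∃ v, p v ∧ Disjoint (Λ v) (univ.biUnion fun j => Λ (w j))
      · obtain ⟨v, hv, hvd⟩ := hv
        rw [Finset.disjoint_biUnion_right] at hvd
        refine Or.inl ⟨Fin.snoc w v, fun j => ?_, fun j l => ?_⟩
        · refine Fin.lastCases ?_ (fun j => ?_) j <;> simp [hv, hw]
        · refine Fin.lastCases ?_ (fun j => ?_) j <;> refine Fin.lastCases ?_ (fun l => ?_) l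
          · simp
          · simpa using fun _ => hvd l (mem_univ l)
          · simpa using (hvd j (mem_univ j)).symm
          · simpa using fun h => hd j l h
      · refine Or.inr ⟨univ.biUnion fun j => Λ (w j), ?_, fun v hpv hdv => hv ⟨v, hpv, hdv⟩⟩
        refine Finset.card_biUnion_le.trans ((Finset.sum_le_sum fun j _ => hB _ (hw j)).trans ?_)
        simp only [sum_const, card_univ, Fintype.card_fin, smul_eq_mul]
        exact Nat.mul_le_mul_right _ n.le_succ
    · exact Or.inr ⟨M, hM.trans (Nat.mul_le_mul_right _ n.le_succ), h⟩

/-- Translation by `c` of the two string symbols. -/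
def shift {S : Type} [AddGroup S] (c : S) : Bool × S × S ≃ Bool × S × S :=
  (Equiv.refl Bool).prodCongr ((Equiv.addRight c).prodCongr (Equiv.addRight c))

lemma compQ_compQ_symm {q L : ℕ} (e : Equiv.Perm (Fin L)) (p : Fin L ⊕ Fin L → ZMod q) :
    compQ e (compQ e.symm p) = p := by
  ext c
  rcases c with i | i <;> simp [compQ]

lemma exists_forall_not {α : Type*} [Finite α] [Nonempty α] {k : ℕ} (hk : 0 < k)
    (p : Fin k → α → Prop) (h : ∀ j, k * Nat.card {z // p j z} < Nat.card α) :
    ∃ z, ∀ j, ¬ p j z := by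
  classical
  have := Fintype.ofFinite α
  by_contra! hc
  have h1 : (univ : Finset α) ⊆ univ.biUnion fun j => univ.filter (p j) := fun z _ => by
    simpa using hc z
  have h2 := (card_le_card h1).trans card_biUnion_le
  have : Nonempty (Fin k) := ⟨⟨0, hk⟩⟩
  have h3 : ∑ j : Fin k, k * (univ.filter (p j)).card < ∑ _j : Fin k, Nat.card α :=
    Finset.sum_lt_sum_of_nonempty univ_nonempty fun j _ => by
      simpa [Nat.card_eq_fintype_card, Fintype.card_subtype] using h j
  rw [← Finset.mul_sum] at h3
  simp only [sum_const, card_univ, Fintype.card_fin, smul_eq_mul, Nat.card_eq_fintype_card] at h3 h2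
  exact absurd (Nat.lt_of_mul_lt_mul_left h3) h2.not_gt

lemma exists_accepted_queries {q k L B : ℕ} [NeZero q] (hk : 0 < k) (a : Fin k → ZMod q)
    (e : Fin k → Equiv.Perm (Fin L)) (P : Fin k → Finset (Fin L ⊕ Fin L → ZMod q))
    (J Λ : Fin k → Finset (Fin L)) (σ : Fin k → Fin L → Bool × ZMod q × ZMod q)
    (hJ : ∀ j, J j ⊆ Λ j) (hJc : ∀ j, (J j).card ≤ B)
    (hd : ∀ j l, j ≠ l → Disjoint ((Λ j).map (e j).toEmbedding) ((Λ l).map (e l).toEmbedding))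
    (h : ∀ j T, Disjoint T (Λ j) → T.card ≤ k * B →
      ∀ θ : Fin L → Bool × ZMod q × ZMod q, (∀ i ∈ J j, θ i = σ j i) →
        k * Nat.card {z : Fin L → Bool × ZMod q × ZMod q //
          ¬ Hit (P j) ((J j ∪ T).piecewise θ z)} <
          Fintype.card (Bool × ZMod q × ZMod q) ^ L) :
    ∃ X : Fin k → Fin L ⊕ Fin L → ZMod q, (∀ j, compQ (e j) (X j) ∈ P j) ∧
      ∀ i, (∃ b, ∀ r, X r (Sum.inl i) = a r + b) ∨ (∃ b, ∀ r, X r (Sum.inr i) = a r + b) := by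
  classical
  let ζ : (Fin L → Bool × ZMod q × ZMod q) → Fin L → Bool × ZMod q × ZMod q := fun z i =>
    if hi : ∃ l, (e l).symm i ∈ J l then
      (shift (a hi.choose)).symm (σ hi.choose ((e hi.choose).symm i)) else z i
  let F : Fin k → (Fin L → Bool × ZMod q × ZMod q) ≃ (Fin L → Bool × ZMod q × ZMod q) :=
    fun j => (e j).symm.arrowCongr (shift (a j))
  have hF : ∀ j z i, F j z i = shift (a j) (z (e j i)) := fun j z i => rfl
  have huniq : ∀ j l i, (e j).symm i ∈ J j → (e l).symm i ∈ J l → l = j := by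
    intro j l i hj hl
    by_contra hne
    refine Finset.disjoint_left.1 (hd l j hne) (?_ : i ∈ _) ?_
    · exact Finset.mem_map_equiv.2 (hJ l hl)
    · exact Finset.mem_map_equiv.2 (hJ j hj)
  have hgood : ∃ z, ∀ j, ¬ ¬ Hit (P j) (F j (ζ z)) := by
    refine exists_forall_not hk _ fun j => ?_
    let T : Finset (Fin L) := univ.filter fun i => ∃ l, l ≠ j ∧ (e l).symm (e j i) ∈ J l
    have hT : Disjoint T (Λ j) := Finset.disjoint_left.2 fun i hi hi' => by
      obtain ⟨l, hl, hil⟩ := (Finset.mem_filter.1 hi).2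
      refine Finset.disjoint_left.1 (hd l j hl) (?_ : e j i ∈ _) ?_
      · exact Finset.mem_map_equiv.2 (hJ l hil)
      · exact Finset.mem_map_equiv.2 (by simpa using hi')
    have hTc : T.card ≤ k * B := by
      have h1 : T ⊆ univ.biUnion fun l => (J l).map ((e l).trans (e j).symm).toEmbedding := by
        intro i hi
        obtain ⟨l, -, hil⟩ := (Finset.mem_filter.1 hi).2
        refine Finset.mem_biUnion.2 ⟨l, mem_univ l, Finset.mem_map_equiv.2 ?_⟩
        simpa using hil
      refine (card_le_card h1).trans (card_biUnion_le.trans ?_)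
      simp only [card_map]
      refine (Finset.sum_le_sum fun l _ => hJc l).trans ?_
      simp
    let θ := F j (ζ fun _ => (true, 0, 0))
    have hθ : ∀ i ∈ J j, θ i = σ j i := fun i hi => by
      have hi' : ∃ l, (e l).symm (e j i) ∈ J l := ⟨j, by simpa using hi⟩
      have hl := huniq j _ (e j i) (by simpa using hi) hi'.choose_spec
      simp only [θ, hF, ζ, dif_pos hi', hl]
      simp
    have hz : ∀ z, F j (ζ z) = (J j ∪ T).piecewise θ (F j z) := fun z => by
      ext1 i
      by_cases hi : ∃ l, (e l).symm (e j i) ∈ J l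
      · have hiJT : i ∈ J j ∪ T := by
          obtain ⟨l, hl⟩ := hi
          by_cases hlj : l = j
          · subst hlj
            exact mem_union_left _ (by simpa using hl)
          · exact mem_union_right _ (Finset.mem_filter.2 ⟨mem_univ i, l, hlj, hl⟩)
        rw [Finset.piecewise_eq_of_mem _ _ _ hiJT]
        simp only [θ, hF, ζ, dif_pos hi]
      · have hiJT : i ∉ J j ∪ T := fun h' => hi <| by
          rcases mem_union.1 h' with h' | h'
          · exact ⟨j, by simpa using h'⟩
          · obtain ⟨l, -, hl⟩ := (Finset.mem_filter.1 h').2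
            exact ⟨l, hl⟩
        rw [Finset.piecewise_eq_of_notMem _ _ _ hiJT]
        simp only [hF, ζ, dif_neg hi]
    have hcard : Nat.card {z // ¬ Hit (P j) (F j (ζ z))} =
        Nat.card {z // ¬ Hit (P j) ((J j ∪ T).piecewise θ z)} :=
      Nat.card_congr ((F j).subtypeEquiv fun z => by rw [hz])
    rw [hcard]
    simpa [Nat.card_eq_fintype_card] using h j T hT hTc θ hθ
  obtain ⟨z, hz⟩ := hgood
  choose p hp hpz using fun j => not_not.1 (hz j)
  refine ⟨fun j => compQ (e j).symm (p j), fun j => by rw [compQ_compQ_symm]; exact hp j,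
    fun i => ?_⟩
  by_cases hi : (ζ z i).1 = true
  · refine Or.inl ⟨(ζ z i).2.1, fun r => ?_⟩
    have := hpz r ((e r).symm i)
    rw [hF, Equiv.apply_symm_apply, if_pos (by simpa [shift] using hi)] at this
    simpa [compQ, shift, add_comm] using this
  · refine Or.inr ⟨(ζ z i).2.2, fun r => ?_⟩
    have := hpz r ((e r).symm i)
    rw [hF, Equiv.apply_symm_apply, if_neg (by simpa [shift] using hi)] at this
    simpa [compQ, shift, add_comm] using this

lemma half_mul_card_le_card_dense {V X : Type*} [Fintype V] [Fintype X] [DecidableEq V]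
    [DecidableEq X] [Nonempty X] {δ : ℝ} (hδ : 0 ≤ δ) (I : Finset (V × X))
    (hI : δ * ((Fintype.card V : ℝ) * Fintype.card X) ≤ I.card) :
    δ / 2 * Fintype.card V ≤ (univ.filter fun v : V =>
      δ / 2 * (Fintype.card X : ℝ) ≤ ((univ.filter fun x => (v, x) ∈ I).card : ℝ)).card := by
  set D := univ.filter fun v : V =>
      δ / 2 * (Fintype.card X : ℝ) ≤ ((univ.filter fun x => (v, x) ∈ I).card : ℝ) with hD
  have hX : (0 : ℝ) < Fintype.card X := by exact_mod_cast Fintype.card_pos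
  have h1 : (I.card : ℝ) = ∑ v : V, ((univ.filter fun x => (v, x) ∈ I).card : ℝ) := by
    have : I = univ.filter fun p : V × X => p ∈ I := by ext; simp
    rw [this, Finset.card_filter, Fintype.sum_prod_type]
    simp only [Finset.card_filter]
    push_cast
    simp
  have h2 : ∑ v : V, ((univ.filter fun x => (v, x) ∈ I).card : ℝ) ≤
      ∑ v : V, ((if v ∈ D then (Fintype.card X : ℝ) else 0) + δ / 2 * Fintype.card X) := by
    refine Finset.sum_le_sum fun v _ => ?_
    by_cases hv : v ∈ D
    · have : ((univ.filter fun x => (v, x) ∈ I).card : ℝ) ≤ Fintype.card X := by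
        exact_mod_cast card_le_univ _
      rw [if_pos hv]
      nlinarith
    · rw [if_neg hv, zero_add]
      simp only [hD, mem_filter, mem_univ, true_and, not_le] at hv
      exact hv.le
  rw [Finset.sum_add_distrib] at h2
  simp only [Finset.sum_ite_mem, univ_inter, sum_const, card_univ, nsmul_eq_mul] at h2
  nlinarith

lemma exists_fin_enumeration {α : Type*} [Nonempty α] {s : Finset α} {n : ℕ} (h : s.card ≤ n) :
    ∃ f : Fin n → α, ∀ x ∈ s, ∃ i, f i = x := by
  refine ⟨fun i => if hi : i.1 < s.card then s.equivFin.symm ⟨i, hi⟩ else Classical.arbitrary α,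
    fun x hx => ⟨⟨s.equivFin ⟨x, hx⟩, (s.equivFin ⟨x, hx⟩).2.trans_le h⟩, ?_⟩⟩
  simp

lemma card_filter_edges {U V : Type*} [Fintype U] [Fintype V] (Adj : U → V → Bool) {d : ℕ}
    (hd : ∀ v, (univ.filter fun u => Adj u v = true).card = d) (p : V → Prop) [DecidablePred p] :
    (univ.filter fun x : U × V => Adj x.1 x.2 = true ∧ p x.2).card =
      (univ.filter p).card * d := by
  rw [Finset.card_filter, Fintype.sum_prod_type_right, Finset.card_filter, Finset.sum_mul]
  refine Finset.sum_congr rfl fun v _ => ?_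
  rw [← hd v, Finset.card_filter]
  by_cases hv : p v <;> simp [hv]

lemma card_le_of_labelings {U V : Type*} [Fintype U] [Fintype V] {L n m : ℕ} {s : ℝ}
    (Adj : U → V → Bool) (π : U → V → Fin L → Fin L)
    (hs : ∀ (ℓU : U → Fin L) (ℓV : V → Fin L),
      ((univ.filter fun p : U × V => Adj p.1 p.2 = true ∧ π p.1 p.2 (ℓV p.2) = ℓU p.1).card : ℝ)
        ≤ s * ((univ.filter fun p : U × V => Adj p.1 p.2 = true).card : ℝ))
    (E : Finset (U × V)) (f : U → Fin n → Fin L) (g : V → Fin m → Fin L)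
    (hE : ∀ x ∈ E, Adj x.1 x.2 = true ∧ ∃ i j, π x.1 x.2 (g x.2 j) = f x.1 i) :
    (E.card : ℝ) ≤ n * m * (s * ((univ.filter fun p : U × V => Adj p.1 p.2 = true).card : ℝ)) := by
  classical
  have h1 : E ⊆ (univ : Finset (Fin n × Fin m)).biUnion fun ij =>
      univ.filter fun p : U × V => Adj p.1 p.2 = true ∧ π p.1 p.2 (g p.2 ij.2) = f p.1 ij.1 := by
    intro x hx
    obtain ⟨ha, i, j, hij⟩ := hE x hx
    simp only [mem_biUnion, mem_univ, true_and, mem_filter]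
    exact ⟨(i, j), ha, hij⟩
  have h2 : (E.card : ℝ) ≤ ∑ ij : Fin n × Fin m, ((univ.filter fun p : U × V =>
      Adj p.1 p.2 = true ∧ π p.1 p.2 (g p.2 ij.2) = f p.1 ij.1).card : ℝ) := by
    exact_mod_cast (card_le_card h1).trans card_biUnion_le
  refine h2.trans ((Finset.sum_le_sum fun ij _ => hs (fun u => f u ij.1) fun v => g v ij.2).trans ?_)
  simp

end Soundness

end LongCodeTest

/-- soundness of the long code test `𝒯₁`: for every `q ≥ 2`, `k ≥ 2` and
`δ > 0` there is `s > 0` (depending only on `δ, q, k`) such that for every Unique-Games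
instance (bi-regular bipartite graph with bijective projections) in which every labeling
satisfies at most an `s` fraction of the edges, the constraint hypergraph of the instance
`𝒢` produced by the long code test `𝒯₁` (with parameter `a ∈ [q]^k`) has no independent
set of fractional size `δ`: there is no `I ⊆ V × [q]^{2L}` with
`|I| ≥ δ·|V|·q^{2L}` such that every test tuple in the support of `𝒯₁` has at least one
of its `k` queried variables outside `I`. -/
theorem stmt_7 :
    ∀ (q k : ℕ), 2 ≤ q → 2 ≤ k → ∀ δ : ℝ, 0 < δ → ∃ s : ℝ, 0 < s ∧
      ∀ (L : ℕ) (U V : Type) [Fintype U] [Fintype V] [DecidableEq V] [Nonempty U]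
        (Adj : U → V → Bool) (π : U → V → Fin L → Fin L),
        (∀ u v, Function.Bijective (π u v)) →
        ∀ (dU dV : ℕ), 0 < dU → 0 < dV →
        (∀ u : U, (Finset.univ.filter (fun v => Adj u v = true)).card = dU) →
        (∀ v : V, (Finset.univ.filter (fun u => Adj u v = true)).card = dV) →
        ∀ a : Fin k → ZMod q,
        (∀ (ℓU : U → Fin L) (ℓV : V → Fin L),
          ((Finset.univ.filter
              (fun p : U × V => Adj p.1 p.2 = true ∧ π p.1 p.2 (ℓV p.2) = ℓU p.1)).card : ℝ)
            ≤ s * ((Finset.univ.filter (fun p : U × V => Adj p.1 p.2 = true)).card : ℝ)) →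
        ¬ ∃ I : Finset (V × ((Fin L ⊕ Fin L) → ZMod q)),
            δ * ((Fintype.card V : ℝ) * (q : ℝ) ^ (2 * L)) ≤ (I.card : ℝ) ∧
            ∀ (u : U) (w : Fin k → V) (X : Fin k → (Fin L ⊕ Fin L) → ZMod q),
              (∀ j, Adj u (w j) = true) →
              (∀ i : Fin L, (∃ b : ZMod q, ∀ r, X r (Sum.inl i) = a r + b) ∨
                            (∃ b : ZMod q, ∀ r, X r (Sum.inr i) = a r + b)) →
              ∃ j : Fin k, (w j, compQ (π u (w j)) (X j)) ∉ I := by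
  intro q k hq hk δ hδ
  have : NeZero q := ⟨by omega⟩
  obtain ⟨B₁, B₂, hB⟩ := exists_core_hit (ZMod q) (k := k) (by omega) (half_pos hδ)
  refine ⟨δ / (4 * (((k * B₂ : ℕ) : ℝ) * B₂ + 1)), by positivity, ?_⟩
  intro L U V _ _ _ _ Adj π hπ dU dV hdU hdV hU hV a hs
  rintro ⟨I, hI, hind⟩
  classical
  let P : V → Finset (Fin L ⊕ Fin L → ZMod q) := fun v => Finset.univ.filter fun x => (v, x) ∈ I
  let D : V → Prop := fun v =>
    δ / 2 * (Fintype.card (Fin L ⊕ Fin L → ZMod q) : ℝ) ≤ ((P v).card : ℝ)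
  have hcardX : Fintype.card (Fin L ⊕ Fin L → ZMod q) = q ^ (2 * L) := by
    simp [ZMod.card, two_mul]
  have hD : δ / 2 * Fintype.card V ≤ (Finset.univ.filter D).card :=
    half_mul_card_le_card_dense hδ.le I (by rw [hcardX]; exact_mod_cast hI)
  have hcore : ∀ v, ∃ (J Λ : Finset (Fin L)) (σ : Fin L → Bool × ZMod q × ZMod q),
      D v → J ⊆ Λ ∧ J.card ≤ B₁ ∧ Λ.card ≤ B₂ ∧ ∀ T, Disjoint T Λ → T.card ≤ k * B₁ →
        ∀ θ : Fin L → Bool × ZMod q × ZMod q, (∀ i ∈ J, θ i = σ i) →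
          k * Nat.card {z : Fin L → Bool × ZMod q × ZMod q //
            ¬ Hit (P v) ((J ∪ T).piecewise θ z)} <
            Fintype.card (Bool × ZMod q × ZMod q) ^ L := fun v => by
    by_cases hv : D v
    · obtain ⟨J, Λ, σ, h⟩ := hB (Fin L) (P v) (by
        have : δ / 2 * (q : ℝ) ^ (2 * L) ≤ (P v).card := by
          have hv' := hv
          simp only [D, hcardX] at hv'
          exact_mod_cast hv'
        simpa [ZMod.card] using this)
      rw [Fintype.card_fin] at h
      exact ⟨J, Λ, σ, fun _ => h⟩
    · exact ⟨∅, ∅, fun _ => (true, 0, 0), fun h => absurd h hv⟩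
  choose J Λ σ hcore using hcore
  let e : U → V → Equiv.Perm (Fin L) := fun u v => Equiv.ofBijective (π u v) (hπ u v)
  have hM : ∀ u, ∃ M : Finset (Fin L), M.card ≤ k * B₂ ∧ ∀ v, Adj u v = true ∧ D v →
      ¬ Disjoint ((Λ v).map (e u v).toEmbedding) M := fun u => by
    refine (exists_pairwise_disjoint_or_hitting_set (fun v => (Λ v).map (e u v).toEmbedding)
      (fun v => Adj u v = true ∧ D v)
      (fun v hv => by simpa using (hcore v hv.2).2.2.1) k).resolve_left ?_
    rintro ⟨w, hw, hd⟩
    obtain ⟨X, hX, hXa⟩ := exists_accepted_queries (by omega) a (fun j => e u (w j))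
      (fun j => P (w j)) (fun j => J (w j)) (fun j => Λ (w j)) (fun j => σ (w j))
      (fun j => (hcore _ (hw j).2).1) (fun j => (hcore _ (hw j).2).2.1) hd
      (fun j => (hcore _ (hw j).2).2.2.2)
    obtain ⟨j, hj⟩ := hind u w X (fun j => (hw j).1) hXa
    exact hj (Finset.mem_filter.1 (hX j)).2
  choose M hMc hMd using hM
  have hV0 : 0 < Fintype.card V := by
    obtain ⟨u⟩ := ‹Nonempty U›
    obtain ⟨v, -⟩ := Finset.card_pos.1 (hdU.trans_eq (hU u).symm)
    exact Fintype.card_pos_iff.2 ⟨v⟩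
  have hE : (Finset.univ.filter fun p : U × V => Adj p.1 p.2 = true).card =
      Fintype.card V * dV := by
    simpa using card_filter_edges Adj hV fun _ => True
  have hDE := card_filter_edges Adj hV D
  have hVR : (0 : ℝ) < Fintype.card V := by exact_mod_cast hV0
  have hdR : (0 : ℝ) < dV := by exact_mod_cast hdV
  have hlabel : ∃ i : Fin L, True := by
    have h1 : 0 < (Finset.univ.filter D).card := by
      have : (0 : ℝ) < (Finset.univ.filter D).card := lt_of_lt_of_le (by positivity) hD
      exact_mod_cast this
    obtain ⟨v, hv⟩ := Finset.card_pos.1 h1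
    obtain ⟨u, hu⟩ := Finset.card_pos.1 (hdV.trans_eq (hV v).symm)
    obtain ⟨i, -, -⟩ := Finset.not_disjoint_iff.1
      (hMd u v ⟨(Finset.mem_filter.1 hu).2, (Finset.mem_filter.1 hv).2⟩)
    exact ⟨i, trivial⟩
  have : Nonempty (Fin L) := ⟨hlabel.choose⟩
  choose f hf using fun u => exists_fin_enumeration (hMc u)
  have hg : ∀ v, ∃ g : Fin B₂ → Fin L, D v → ∀ x ∈ Λ v, ∃ i, g i = x := fun v => by
    by_cases hv : D v
    · obtain ⟨g, hg⟩ := exists_fin_enumeration (hcore v hv).2.2.1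
      exact ⟨g, fun _ => hg⟩
    · exact ⟨fun _ => Classical.arbitrary _, fun h => absurd h hv⟩
  choose g hg using hg
  have key := card_le_of_labelings Adj π hs
    (Finset.univ.filter fun x : U × V => Adj x.1 x.2 = true ∧ D x.2) f g fun x hx => by
      obtain ⟨hadj, hDx⟩ := (Finset.mem_filter.1 hx).2
      obtain ⟨i, hi, hiM⟩ := Finset.not_disjoint_iff.1 (hMd x.1 x.2 ⟨hadj, hDx⟩)
      obtain ⟨i', hi', rfl⟩ := Finset.mem_map.1 hi
      obtain ⟨t, ht⟩ := hf x.1 _ hiM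
      obtain ⟨r, hr⟩ := hg x.2 hDx i' hi'
      exact ⟨hadj, t, r, by rw [ht, hr]; rfl⟩
  rw [hDE, hE] at key
  push_cast at key
  set c : ℝ := (k : ℝ) * B₂ * B₂ with hc
  have hc0 : 0 ≤ c := by positivity
  have h1 : c * (δ / (4 * (c + 1))) ≤ δ / 4 := by
    rw [mul_div_assoc', div_le_div_iff₀ (by positivity) (by norm_num)]
    nlinarith
  have h2 : δ / 2 * Fintype.card V * dV ≤ (Finset.univ.filter D).card * (dV : ℝ) := by gcongr
  have h3 : c * (δ / (4 * (c + 1)) * ((Fintype.card V : ℝ) * dV)) ≤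
      δ / 4 * ((Fintype.card V : ℝ) * dV) := by
    rw [← mul_assoc]
    gcongr
  have h4 : 0 < δ * ((Fintype.card V : ℝ) * dV) := by positivity
  linarith [h2.trans (key.trans h3)]
end

section
/- Let k, d ≥ 1 and ε ∈ (0, 1/2]. Let 𝒫₀ and 𝒫₁ be probability distributions on {0,1}^k such that every single-coordinate marginal of each is uniform, every string in the support of 𝒫₀ has even parity, and every string in the support of 𝒫₁ has odd parity. Let 𝒯 be the following distribution on pairs (X, Y) of k × 2d binary matrices: choose a uniform bit c₁; if c₁ = 0, draw the 2d columns of X i.i.d. from 𝒫₀ and the 2d columns of Y i.i.d. from 𝒫₁; if c₁ = 1, swap the roles of 𝒫₀ and 𝒫₁; then choose c₂ ∈ {*, 0, 1} with Pr[c₂ = *] = 1 − 2ε and Pr[c₂ = 0] = Pr[c₂ = 1] = ε; if c₂ = 0, resample columns d+1, …, 2d of both X and Y uniformly at random; if c₂ = 1, resample columns 1, …, d of both X and Y uniformly at random. Let Y_k denote the last row of Y and Y_{−k} the first k − 1 rows. Then the correlation satisfies ρ( (X, Y_{−k}), Y_k ; 𝒯 ) ≤ sqrt(1 − ε). -/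
open Finset

/-- Choose `P1` if `b = true`, else `P0`. -/
def pick {k : ℕ} (P0 P1 : (Fin k → Bool) → ℝ) (b : Bool) : (Fin k → Bool) → ℝ :=
  if b = true then P1 else P0

/-- Mass function of the distribution `𝒯` on pairs `(X, Y)` of `k × 2d` binary matrices
(columns indexed by `Fin d ⊕ Fin d`; `Sum.inl` are columns `1, …, d`, `Sum.inr` are
columns `d+1, …, 2d`): pick a uniform bit `c₁` deciding whether `X` has i.i.d. `𝒫₀`
columns and `Y` i.i.d. `𝒫₁` columns or vice versa; then with probability `1 − 2ε` keep
the matrices, with probability `ε` resample the last `d` columns of both uniformly, and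
with probability `ε` resample the first `d` columns of both uniformly. -/
noncomputable def massT (k d : ℕ) (ε : ℝ) (P0 P1 : (Fin k → Bool) → ℝ)
    (X Y : Fin k → (Fin d ⊕ Fin d) → Bool) : ℝ :=
  (1 / 2) * ∑ b : Bool,
    ((1 - 2 * ε) *
        ((∏ c : Fin d ⊕ Fin d, pick P0 P1 b (fun j => X j c)) *
         (∏ c : Fin d ⊕ Fin d, pick P0 P1 (!b) (fun j => Y j c)))
     + ε * ((∏ c : Fin d, pick P0 P1 b (fun j => X j (Sum.inl c))) *
            (∏ c : Fin d, pick P0 P1 (!b) (fun j => Y j (Sum.inl c)))) *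
          ((1 : ℝ) / 2 ^ k) ^ (2 * d)
     + ε * ((∏ c : Fin d, pick P0 P1 b (fun j => X j (Sum.inr c))) *
            (∏ c : Fin d, pick P0 P1 (!b) (fun j => Y j (Sum.inr c)))) *
          ((1 : ℝ) / 2 ^ k) ^ (2 * d))

section Flip

variable {k : ℕ} {C : Type*}

/-- Flip the entries of `y` at the positions where `z` is `true`. -/
def flipMask (z y : C → Bool) : C → Bool := fun c => xor (z c) (y c)

/-- Flipping the entries of row `j` selected by `z`, as a permutation of matrices. -/
def flipRow (j : Fin k) (z : C → Bool) : Equiv.Perm (Fin k → C → Bool) :=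
  Function.Involutive.toPerm (fun Y => Function.update Y j (flipMask z (Y j))) fun Y => by
    ext i c
    by_cases h : i = j
    · subst h; simp [flipMask]
    · simp [Function.update_of_ne h]

lemma flipRow_apply_self (j : Fin k) (z : C → Bool) (Y : Fin k → C → Bool) :
    flipRow j z Y j = flipMask z (Y j) :=
  Function.update_self ..

lemma flipRow_apply_ne {i j : Fin k} (h : i ≠ j) (z : C → Bool) (Y : Fin k → C → Bool) :
    flipRow j z Y i = Y i :=
  Function.update_of_ne h ..

end Flip

/-- The mass function of a `k`-row matrix whose columns are independent, column `c` having
mass function `q c`. -/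
def colMass {k : ℕ} {C : Type*} [Fintype C] (q : C → (Fin k → Bool) → ℝ)
    (X : Fin k → C → Bool) : ℝ :=
  ∏ c, q c (fun j => X j c)

section Columns

variable {k : ℕ} {C : Type*} [Fintype C]

lemma colMass_nonneg {q : C → (Fin k → Bool) → ℝ} (hq : ∀ c x, 0 ≤ q c x)
    (X : Fin k → C → Bool) : 0 ≤ colMass q X :=
  Finset.prod_nonneg fun c _ => hq c _

lemma colMass_flipRow (q : C → (Fin k → Bool) → ℝ) (j : Fin k) (z : C → Bool)
    (hz : ∀ c, z c = true → ∀ x y, q c x = q c y) (Y : Fin k → C → Bool) :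
    colMass q (flipRow j z Y) = colMass q Y := by
  refine Finset.prod_congr rfl fun c _ => ?_
  by_cases h : z c = true
  · exact hz c h _ _
  · congr 1
    ext i
    by_cases hi : i = j
    · subst hi
      simp [flipRow_apply_self, flipMask, h]
    · rw [flipRow_apply_ne hi]

variable [DecidableEq C]

lemma sum_colMass_mul_row (q : C → (Fin k → Bool) → ℝ) (j : Fin k)
    (hq : ∀ c b, ∑ x ∈ univ.filter (fun x : Fin k → Bool => x j = b), q c x = 1 / 2)
    (φ : (C → Bool) → ℝ) :
    ∑ X, colMass q X * φ (X j) = (1 / 2) ^ Fintype.card C * ∑ y, φ y := by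
  have hfib : ∀ y : C → Bool,
      ∑ Z ∈ univ.filter (fun Z : C → Fin k → Bool => (fun c => Z c j) = y), ∏ c, q c (Z c)
        = (1 / 2) ^ Fintype.card C := by
    intro y
    have hset : univ.filter (fun Z : C → Fin k → Bool => (fun c => Z c j) = y)
        = Fintype.piFinset fun c => univ.filter (fun x : Fin k → Bool => x j = y c) := by
      ext Z
      simp [Fintype.mem_piFinset, funext_iff]
    rw [hset, ← Finset.prod_univ_sum]
    simp [hq]
  rw [← (Equiv.piComm (fun (_ : C) (_ : Fin k) => Bool)).sum_comp]
  rw [← Finset.sum_fiberwise univ (fun Z : C → Fin k → Bool => fun c => Z c j), Finset.mul_sum]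
  refine Finset.sum_congr rfl fun y _ => ?_
  rw [← hfib y, Finset.sum_mul]
  refine Finset.sum_congr rfl fun Z hZ => ?_
  rw [← (Finset.mem_filter.mp hZ).2]
  rfl

lemma sum_colMass (q : C → (Fin k → Bool) → ℝ) (j : Fin k)
    (hq : ∀ c b, ∑ x ∈ univ.filter (fun x : Fin k → Bool => x j = b), q c x = 1 / 2) :
    ∑ X, colMass q X = 1 := by
  have h := sum_colMass_mul_row q j hq (fun _ => 1)
  simpa [← mul_pow] using h

lemma sum_colMass_colMass_mul_row (q q' : C → (Fin k → Bool) → ℝ) (j : Fin k)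
    (hq : ∀ c b, ∑ x ∈ univ.filter (fun x : Fin k → Bool => x j = b), q c x = 1 / 2)
    (hq' : ∀ c b, ∑ x ∈ univ.filter (fun x : Fin k → Bool => x j = b), q' c x = 1 / 2)
    (φ : (C → Bool) → ℝ) :
    ∑ X, ∑ Y, colMass q X * colMass q' Y * φ (Y j)
      = (1 / 2) ^ Fintype.card C * ∑ y, φ y := by
  simp_rw [mul_assoc, ← Finset.mul_sum, sum_colMass_mul_row q' j hq' φ, ← Finset.sum_mul,
    sum_colMass q j hq, one_mul]

lemma two_mul_sum_colMass_mul_le (q q' : C → (Fin k → Bool) → ℝ) (j : Fin k)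
    (hq0 : ∀ c x, 0 ≤ q c x) (hq0' : ∀ c x, 0 ≤ q' c x)
    (hq : ∀ c b, ∑ x ∈ univ.filter (fun x : Fin k → Bool => x j = b), q c x = 1 / 2)
    (hq' : ∀ c b, ∑ x ∈ univ.filter (fun x : Fin k → Bool => x j = b), q' c x = 1 / 2)
    (F : (Fin k → C → Bool) → (Fin k → C → Bool) → ℝ) (φ : (C → Bool) → ℝ)
    {s : ℝ} (hs : 0 < s) :
    2 * ∑ X, ∑ Y, colMass q X * colMass q' Y * (F X Y * φ (Y j))
      ≤ s * ∑ X, ∑ Y, colMass q X * colMass q' Y * F X Y ^ 2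
        + s⁻¹ * ((1 / 2) ^ Fintype.card C * ∑ y, φ y ^ 2) := by
  rw [← sum_colMass_colMass_mul_row q q' j hq hq' (fun y => φ y ^ 2)]
  simp only [Finset.mul_sum, ← Finset.sum_add_distrib]
  refine Finset.sum_le_sum fun X _ => Finset.sum_le_sum fun Y _ => ?_
  have hw : 0 ≤ colMass q X * colMass q' Y :=
    mul_nonneg (colMass_nonneg hq0 X) (colMass_nonneg hq0' Y)
  have h : 2 * (F X Y * φ (Y j)) ≤ s * F X Y ^ 2 + s⁻¹ * φ (Y j) ^ 2 := by
    have h1 : 0 ≤ s⁻¹ * (s * F X Y - φ (Y j)) ^ 2 := by positivity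
    have h2 : s⁻¹ * (s * F X Y - φ (Y j)) ^ 2
        = s * F X Y ^ 2 + s⁻¹ * φ (Y j) ^ 2 - 2 * (F X Y * φ (Y j)) := by
      field_simp
      ring
    linarith
  nlinarith [mul_le_mul_of_nonneg_left h hw]

/-- If the columns selected by the masks `z i` are uniformly distributed and `F` does not
depend on row `j`, a function of row `j` may be replaced by its average over the masks. -/
lemma sum_colMass_mul_eq_average {ι : Type*} [Fintype ι] [Nonempty ι]
    (q q' : C → (Fin k → Bool) → ℝ) (j : Fin k) (z : ι → C → Bool)
    (hz : ∀ i c, z i c = true → ∀ x y, q' c x = q' c y)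
    (F : (Fin k → C → Bool) → (Fin k → C → Bool) → ℝ)
    (hF : ∀ X Y i, F X (flipRow j (z i) Y) = F X Y) (φ : (C → Bool) → ℝ) :
    ∑ X, ∑ Y, colMass q X * colMass q' Y * (F X Y * φ (Y j))
      = ∑ X, ∑ Y, colMass q X * colMass q' Y *
          (F X Y * ((∑ i, φ (flipMask (z i) (Y j))) / Fintype.card ι)) := by
  refine Finset.sum_congr rfl fun X _ => ?_
  have hi : ∀ i, ∑ Y, colMass q X * colMass q' Y * (F X Y * φ (Y j))
      = ∑ Y, colMass q X * colMass q' Y * (F X Y * φ (flipMask (z i) (Y j))) := by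
    intro i
    rw [← Equiv.sum_comp (flipRow j (z i))]
    simp_rw [colMass_flipRow q' j (z i) (hz i), hF, flipRow_apply_self]
  have hc : (Fintype.card ι : ℝ) ≠ 0 := by exact_mod_cast Fintype.card_ne_zero
  have hsum : (Fintype.card ι : ℝ) * ∑ Y, colMass q X * colMass q' Y * (F X Y * φ (Y j))
      = ∑ i, ∑ Y, colMass q X * colMass q' Y * (F X Y * φ (flipMask (z i) (Y j))) := by
    rw [← Finset.sum_congr rfl fun i _ => hi i]
    simp
  rw [← mul_right_inj' hc, hsum, Finset.sum_comm, Finset.mul_sum]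
  refine Finset.sum_congr rfl fun Y _ => ?_
  rw [← Finset.mul_sum, ← Finset.mul_sum]
  field_simp

end Columns

/-- For a function with zero total, the projections onto functions of either coordinate are
orthogonal. -/
lemma sum_sq_average_add_le {A B : Type*} [Fintype A] [Fintype B] [Nonempty A] [Nonempty B]
    (G : A → B → ℝ) (hG : ∑ a, ∑ b, G a b = 0) :
    ∑ a, ∑ _b : B, ((∑ b, G a b) / Fintype.card B) ^ 2
      + ∑ _a : A, ∑ b, ((∑ a, G a b) / Fintype.card A) ^ 2 ≤ ∑ a, ∑ b, G a b ^ 2 := by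
  have hA : (Fintype.card A : ℝ) ≠ 0 := by exact_mod_cast Fintype.card_ne_zero
  have hB : (Fintype.card B : ℝ) ≠ 0 := by exact_mod_cast Fintype.card_ne_zero
  set r : A → ℝ := fun a => (∑ b, G a b) / Fintype.card B with hr
  set t : B → ℝ := fun b => (∑ a, G a b) / Fintype.card A with ht
  have hrow : ∀ a, ∑ b, G a b = Fintype.card B * r a := fun a => by simp only [hr]; field_simp
  have hcol : ∀ b, ∑ a, G a b = Fintype.card A * t b := fun b => by simp only [ht]; field_simp
  have hr0 : ∑ a, r a = 0 := by simp only [hr]; rw [← Finset.sum_div, hG, zero_div]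
  have hGr : ∑ a, ∑ b, G a b * r a = ∑ a, ∑ _b : B, r a ^ 2 := by
    refine Finset.sum_congr rfl fun a _ => ?_
    rw [← Finset.sum_mul, hrow]
    simp
    ring
  have hGt : ∑ a, ∑ b, G a b * t b = ∑ _a : A, ∑ b, t b ^ 2 := by
    rw [Finset.sum_comm, Finset.sum_comm (f := fun (_ : A) b => t b ^ 2)]
    refine Finset.sum_congr rfl fun b _ => ?_
    rw [← Finset.sum_mul, hcol]
    simp
    ring
  have hrt : ∑ a, ∑ b, r a * t b = 0 := by
    simp_rw [← Finset.mul_sum, ← Finset.sum_mul, hr0, zero_mul]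
  have hpos : 0 ≤ ∑ a, ∑ b, (G a b - r a - t b) ^ 2 := by positivity
  have hexp : ∑ a, ∑ b, (G a b - r a - t b) ^ 2
      = ∑ a, ∑ b, G a b ^ 2 + ∑ a, ∑ _b : B, r a ^ 2 + ∑ _a : A, ∑ b, t b ^ 2
        - 2 * ∑ a, ∑ b, G a b * r a - 2 * ∑ a, ∑ b, G a b * t b
        + 2 * ∑ a, ∑ b, r a * t b := by
    simp only [Finset.mul_sum, ← Finset.sum_add_distrib, ← Finset.sum_sub_distrib]
    refine Finset.sum_congr rfl fun a _ => Finset.sum_congr rfl fun b _ => ?_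
    ring
  change ∑ a, ∑ _b : B, r a ^ 2 + ∑ _a : A, ∑ b, t b ^ 2 ≤ _
  linarith

section Halves

variable {A B : Type*}

/-- The mask on `A ⊕ B` that is `z` on `B`. -/
def maskInr (z : B → Bool) : A ⊕ B → Bool := Sum.elim (fun _ => false) z

/-- The mask on `A ⊕ B` that is `z` on `A`. -/
def maskInl (z : A → Bool) : A ⊕ B → Bool := Sum.elim z (fun _ => false)

lemma sum_flipMask [Fintype A] [DecidableEq A] (φ : (A → Bool) → ℝ) (y : A → Bool) :
    ∑ z, φ (flipMask z y) = ∑ z, φ z := by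
  have hinv : Function.Involutive fun z : A → Bool => flipMask z y := fun z => by
    ext c
    simp [flipMask]
  exact Equiv.sum_comp hinv.toPerm φ

lemma sum_flipMask_maskInr [Fintype B] [DecidableEq B] (φ : (A ⊕ B → Bool) → ℝ)
    (u : A → Bool) (v : B → Bool) :
    ∑ z : B → Bool, φ (flipMask (maskInr z) (Sum.elim u v)) = ∑ z, φ (Sum.elim u z) := by
  rw [← sum_flipMask (fun z => φ (Sum.elim u z)) v]
  refine Finset.sum_congr rfl fun z _ => congrArg φ ?_
  ext c
  cases c <;> simp [flipMask, maskInr]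

lemma sum_flipMask_maskInl [Fintype A] [DecidableEq A] (φ : (A ⊕ B → Bool) → ℝ)
    (u : A → Bool) (v : B → Bool) :
    ∑ z : A → Bool, φ (flipMask (maskInl z) (Sum.elim u v)) = ∑ z, φ (Sum.elim z v) := by
  rw [← sum_flipMask (fun z => φ (Sum.elim z v)) u]
  refine Finset.sum_congr rfl fun z _ => congrArg φ ?_
  ext c
  cases c <;> simp [flipMask, maskInl]

variable [Fintype A] [Fintype B] [DecidableEq A] [DecidableEq B]

lemma sum_bool_sum (φ : (A ⊕ B → Bool) → ℝ) : ∑ y, φ y = ∑ u, ∑ v, φ (Sum.elim u v) := by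
  rw [← (Equiv.sumArrowEquivProdArrow A B Bool).symm.sum_comp, Fintype.sum_prod_type]
  rfl

lemma sum_sq_average_mask_add_le (g : (A ⊕ B → Bool) → ℝ) (hg : ∑ y, g y = 0) :
    ∑ y, ((∑ z : B → Bool, g (flipMask (maskInr z) y)) / Fintype.card (B → Bool)) ^ 2
      + ∑ y, ((∑ z : A → Bool, g (flipMask (maskInl z) y)) / Fintype.card (A → Bool)) ^ 2
      ≤ ∑ y, g y ^ 2 := by
  rw [sum_bool_sum] at hg
  rw [sum_bool_sum, sum_bool_sum, sum_bool_sum]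
  simp_rw [sum_flipMask_maskInr, sum_flipMask_maskInl]
  exact sum_sq_average_add_le (fun u v => g (Sum.elim u v)) hg

end Halves

lemma sum_filter_uniform {k : ℕ} (j : Fin k) (b : Bool) :
    ∑ _x ∈ univ.filter (fun x : Fin k → Bool => x j = b), (1 : ℝ) / 2 ^ k = 1 / 2 := by
  have hflip : ∀ b : Bool, ∑ _x ∈ univ.filter (fun x : Fin k → Bool => x j = b), (1 : ℝ) / 2 ^ k
      = ∑ _x ∈ univ.filter (fun x : Fin k → Bool => x j = !b), (1 : ℝ) / 2 ^ k := by
    intro b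
    refine Finset.sum_nbij' (fun x i => !x i) (fun x i => !x i) ?_ ?_ ?_ ?_ ?_ <;> simp
  have htot : ∑ b : Bool, ∑ _x ∈ univ.filter (fun x : Fin k → Bool => x j = b), (1 : ℝ) / 2 ^ k
      = 1 := by
    rw [Finset.sum_fiberwise]
    simp
  have h := hflip b
  rw [Fintype.sum_bool] at htot
  cases b <;> simp only [Bool.not_true, Bool.not_false] at h <;> linarith

/-- Column masses `p` on the left half, uniform on the right half. -/
noncomputable def uniformInr {k : ℕ} (d : ℕ) (p : (Fin k → Bool) → ℝ) :
    Fin d ⊕ Fin d → (Fin k → Bool) → ℝ :=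
  Sum.elim (fun _ => p) (fun _ _ => 1 / 2 ^ k)

/-- Column masses `p` on the right half, uniform on the left half. -/
noncomputable def uniformInl {k : ℕ} (d : ℕ) (p : (Fin k → Bool) → ℝ) :
    Fin d ⊕ Fin d → (Fin k → Bool) → ℝ :=
  Sum.elim (fun _ _ => 1 / 2 ^ k) (fun _ => p)

section Mixture

variable {k d : ℕ}

lemma massT_eq (ε : ℝ) (P0 P1 : (Fin k → Bool) → ℝ) (X Y : Fin k → Fin d ⊕ Fin d → Bool) :
    massT k d ε P0 P1 X Y = (1 / 2) * ∑ b : Bool,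
      ((1 - 2 * ε) *
          (colMass (fun _ => pick P0 P1 b) X * colMass (fun _ => pick P0 P1 (!b)) Y)
        + ε * (colMass (uniformInr d (pick P0 P1 b)) X *
            colMass (uniformInr d (pick P0 P1 (!b))) Y)
        + ε * (colMass (uniformInl d (pick P0 P1 b)) X *
            colMass (uniformInl d (pick P0 P1 (!b))) Y)) := by
  unfold massT
  congr 1
  refine Finset.sum_congr rfl fun b _ => ?_
  simp only [colMass, uniformInr, uniformInl, Fintype.prod_sum_type, Sum.elim_inl, Sum.elim_inr,
    Finset.prod_const, Finset.card_univ, Fintype.card_fin, two_mul d, pow_add]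
  ring

lemma sum_massT_mul (ε : ℝ) (P0 P1 : (Fin k → Bool) → ℝ)
    (H : (Fin k → Fin d ⊕ Fin d → Bool) → (Fin k → Fin d ⊕ Fin d → Bool) → ℝ) :
    ∑ X, ∑ Y, massT k d ε P0 P1 X Y * H X Y = (1 / 2) * ∑ b : Bool,
      ((1 - 2 * ε) * ∑ X, ∑ Y,
          colMass (fun _ => pick P0 P1 b) X * colMass (fun _ => pick P0 P1 (!b)) Y * H X Y
        + ε * ∑ X, ∑ Y, colMass (uniformInr d (pick P0 P1 b)) X *
            colMass (uniformInr d (pick P0 P1 (!b))) Y * H X Y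
        + ε * ∑ X, ∑ Y, colMass (uniformInl d (pick P0 P1 b)) X *
            colMass (uniformInl d (pick P0 P1 (!b))) Y * H X Y) := by
  simp only [massT_eq, Fintype.sum_bool, Finset.mul_sum, ← Finset.sum_add_distrib]
  refine Finset.sum_congr rfl fun X _ => Finset.sum_congr rfl fun Y _ => ?_
  ring

lemma uniformInr_nonneg {p : (Fin k → Bool) → ℝ} (hp : ∀ x, 0 ≤ p x) (c : Fin d ⊕ Fin d)
    (x : Fin k → Bool) : 0 ≤ uniformInr d p c x := by
  cases c
  · exact hp x
  · simp [uniformInr]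

lemma uniformInl_nonneg {p : (Fin k → Bool) → ℝ} (hp : ∀ x, 0 ≤ p x) (c : Fin d ⊕ Fin d)
    (x : Fin k → Bool) : 0 ≤ uniformInl d p c x := by
  cases c
  · simp [uniformInl]
  · exact hp x

lemma sum_filter_uniformInr {p : (Fin k → Bool) → ℝ} {j : Fin k}
    (hp : ∀ b, ∑ x ∈ univ.filter (fun x : Fin k → Bool => x j = b), p x = 1 / 2)
    (c : Fin d ⊕ Fin d) (b : Bool) :
    ∑ x ∈ univ.filter (fun x : Fin k → Bool => x j = b), uniformInr d p c x = 1 / 2 := by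
  cases c
  · exact hp b
  · exact sum_filter_uniform j b

lemma sum_filter_uniformInl {p : (Fin k → Bool) → ℝ} {j : Fin k}
    (hp : ∀ b, ∑ x ∈ univ.filter (fun x : Fin k → Bool => x j = b), p x = 1 / 2)
    (c : Fin d ⊕ Fin d) (b : Bool) :
    ∑ x ∈ univ.filter (fun x : Fin k → Bool => x j = b), uniformInl d p c x = 1 / 2 := by
  cases c
  · exact sum_filter_uniform j b
  · exact hp b

lemma sum_massT_mul_row (ε : ℝ) {P0 P1 : (Fin k → Bool) → ℝ} (j : Fin k)
    (hm : ∀ a b, ∑ x ∈ univ.filter (fun x : Fin k → Bool => x j = b), pick P0 P1 a x = 1 / 2)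
    (φ : (Fin d ⊕ Fin d → Bool) → ℝ) :
    ∑ X, ∑ Y, massT k d ε P0 P1 X Y * φ (Y j)
      = (1 / 2) ^ Fintype.card (Fin d ⊕ Fin d) * ∑ y, φ y := by
  rw [sum_massT_mul ε P0 P1 (fun _ Y => φ (Y j))]
  have h1 := fun b => sum_colMass_colMass_mul_row (C := Fin d ⊕ Fin d) (fun _ => pick P0 P1 b)
    (fun _ => pick P0 P1 (!b)) j (fun _ => hm b) (fun _ => hm (!b)) φ
  have h2 := fun b => sum_colMass_colMass_mul_row (uniformInr d (pick P0 P1 b))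
    (uniformInr d (pick P0 P1 (!b))) j (sum_filter_uniformInr (hm b))
    (sum_filter_uniformInr (hm (!b))) φ
  have h3 := fun b => sum_colMass_colMass_mul_row (uniformInl d (pick P0 P1 b))
    (uniformInl d (pick P0 P1 (!b))) j (sum_filter_uniformInl (hm b))
    (sum_filter_uniformInl (hm (!b))) φ
  simp_rw [h1, h2, h3, Fintype.sum_bool]
  ring

/-- One-sided correlation bound for a function `F` not depending on row `j` of the second
matrix against a function `g` of that row. -/
lemma sum_massT_mul_row_le {ε : ℝ} (hε : 0 < ε) (hε' : ε ≤ 1 / 2)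
    {P0 P1 : (Fin k → Bool) → ℝ} (j : Fin k) (hP : ∀ a x, 0 ≤ pick P0 P1 a x)
    (hm : ∀ a b, ∑ x ∈ univ.filter (fun x : Fin k → Bool => x j = b), pick P0 P1 a x = 1 / 2)
    (F : (Fin k → Fin d ⊕ Fin d → Bool) → (Fin k → Fin d ⊕ Fin d → Bool) → ℝ)
    (hF : ∀ X Y z, F X (flipRow j z Y) = F X Y) (g : (Fin d ⊕ Fin d → Bool) → ℝ)
    (hg0 : ∑ X, ∑ Y, massT k d ε P0 P1 X Y * g (Y j) = 0)
    (hF2 : ∑ X, ∑ Y, massT k d ε P0 P1 X Y * F X Y ^ 2 ≤ 1)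
    (hg2 : ∑ X, ∑ Y, massT k d ε P0 P1 X Y * g (Y j) ^ 2 ≤ 1) :
    ∑ X, ∑ Y, massT k d ε P0 P1 X Y * (F X Y * g (Y j)) ≤ Real.sqrt (1 - ε) := by
  set s := Real.sqrt (1 - ε) with hs
  have hs0 : 0 < s := Real.sqrt_pos.mpr (by linarith)
  have hss : s * s = 1 - ε := Real.mul_self_sqrt (by linarith)
  rw [sum_massT_mul_row ε j hm] at hg0
  rw [sum_massT_mul_row ε j hm (fun y => g y ^ 2)] at hg2
  set N : ℝ := (1 / 2) ^ Fintype.card (Fin d ⊕ Fin d) with hN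
  have hN0 : 0 < N := by positivity
  have hg0' : ∑ y, g y = 0 := by
    rcases mul_eq_zero.mp hg0 with h | h
    · exact absurd h hN0.ne'
    · exact h
  set gl : (Fin d ⊕ Fin d → Bool) → ℝ := fun y =>
    (∑ z : Fin d → Bool, g (flipMask (maskInr z) y)) / Fintype.card (Fin d → Bool) with hgl
  set gr : (Fin d ⊕ Fin d → Bool) → ℝ := fun y =>
    (∑ z : Fin d → Bool, g (flipMask (maskInl z) y)) / Fintype.card (Fin d → Bool) with hgr
  have hproj : ∑ y, gl y ^ 2 + ∑ y, gr y ^ 2 ≤ ∑ y, g y ^ 2 :=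
    sum_sq_average_mask_add_le g hg0'
  have h1 := fun b => two_mul_sum_colMass_mul_le (C := Fin d ⊕ Fin d) (fun _ => pick P0 P1 b)
    (fun _ => pick P0 P1 (!b)) j (fun _ => hP b) (fun _ => hP (!b)) (fun _ => hm b)
    (fun _ => hm (!b)) F g hs0
  have h2 := fun b => two_mul_sum_colMass_mul_le (uniformInr d (pick P0 P1 b))
    (uniformInr d (pick P0 P1 (!b))) j (uniformInr_nonneg (hP b)) (uniformInr_nonneg (hP (!b)))
    (sum_filter_uniformInr (hm b)) (sum_filter_uniformInr (hm (!b))) F gl hs0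
  have h3 := fun b => two_mul_sum_colMass_mul_le (uniformInl d (pick P0 P1 b))
    (uniformInl d (pick P0 P1 (!b))) j (uniformInl_nonneg (hP b)) (uniformInl_nonneg (hP (!b)))
    (sum_filter_uniformInl (hm b)) (sum_filter_uniformInl (hm (!b))) F gr hs0
  have e2 := fun b => sum_colMass_mul_eq_average (uniformInr d (pick P0 P1 b))
    (uniformInr d (pick P0 P1 (!b))) j (fun z : Fin d → Bool => maskInr z)
    (by rintro z (c | c) hc x y <;> simp_all [maskInr, uniformInr]) F (fun X Y z => hF X Y _) g
  have e3 := fun b => sum_colMass_mul_eq_average (uniformInl d (pick P0 P1 b))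
    (uniformInl d (pick P0 P1 (!b))) j (fun z : Fin d → Bool => maskInl z)
    (by rintro z (c | c) hc x y <;> simp_all [maskInl, uniformInl]) F (fun X Y z => hF X Y _) g
  rw [sum_massT_mul] at hF2 ⊢
  simp_rw [e2, e3]
  rw [Fintype.sum_bool] at hF2 ⊢
  have hε2 : 0 ≤ 1 - 2 * ε := by linarith
  have m1 := fun b => mul_le_mul_of_nonneg_left (h1 b) hε2
  have m2 := fun b => mul_le_mul_of_nonneg_left (h2 b) hε.le
  have m3 := fun b => mul_le_mul_of_nonneg_left (h3 b) hε.le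
  have hFs := mul_le_mul_of_nonneg_left hF2 hs0.le
  have hgs : s⁻¹ * ((1 - 2 * ε) * (N * ∑ y, g y ^ 2) + ε * (N * ∑ y, gl y ^ 2)
      + ε * (N * ∑ y, gr y ^ 2)) ≤ s := by
    have h : (1 - 2 * ε) * (N * ∑ y, g y ^ 2) + ε * (N * ∑ y, gl y ^ 2)
        + ε * (N * ∑ y, gr y ^ 2) ≤ s * s := by
      have := mul_le_mul_of_nonneg_left hproj (mul_pos hε hN0).le
      have := mul_le_mul_of_nonneg_left hg2 (by linarith : 0 ≤ 1 - ε)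
      linarith
    rw [inv_mul_le_iff₀ hs0]
    exact h
  have := m1 true
  have := m1 false
  have := m2 true
  have := m2 false
  have := m3 true
  have := m3 false
  linarith

end Mixture

/-- if `𝒫₀, 𝒫₁` are distributions on `{0,1}^k` with uniform single-coordinate
marginals and even-parity, resp. odd-parity, supports, then for the distribution `𝒯` above
the correlation `ρ((X, Y_{-k}), Y_k; 𝒯)` is at most `√(1 − ε)`: for all mean-zero,
second-moment-at-most-one test functions `f` of `(X, Y_{-k})` and `g` of the last row
`Y_k`, `|E[f·g]| ≤ √(1 − ε)`. -/
theorem stmt_9 (k d : ℕ) (hk : 1 ≤ k) (hd : 1 ≤ d) (ε : ℝ) (hε : 0 < ε ∧ ε ≤ 1 / 2)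
    (P0 P1 : (Fin k → Bool) → ℝ)
    (hP0 : ∀ x, 0 ≤ P0 x) (hP1 : ∀ x, 0 ≤ P1 x)
    (hP0s : ∑ x, P0 x = 1) (hP1s : ∑ x, P1 x = 1)
    (hP0m : ∀ (j : Fin k) (b : Bool),
      ∑ x ∈ univ.filter (fun x : Fin k → Bool => x j = b), P0 x = 1 / 2)
    (hP1m : ∀ (j : Fin k) (b : Bool),
      ∑ x ∈ univ.filter (fun x : Fin k → Bool => x j = b), P1 x = 1 / 2)
    (hP0p : ∀ x : Fin k → Bool, P0 x ≠ 0 →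
      Even (univ.filter (fun i => x i = true)).card)
    (hP1p : ∀ x : Fin k → Bool, P1 x ≠ 0 →
      Odd (univ.filter (fun i => x i = true)).card)
    (f : ((Fin k → (Fin d ⊕ Fin d) → Bool) × (Fin (k - 1) → (Fin d ⊕ Fin d) → Bool)) → ℝ)
    (g : ((Fin d ⊕ Fin d) → Bool) → ℝ)
    (hf0 : ∑ X : Fin k → (Fin d ⊕ Fin d) → Bool, ∑ Y : Fin k → (Fin d ⊕ Fin d) → Bool,
      massT k d ε P0 P1 X Y * f (X, fun j => Y (Fin.castLE (Nat.sub_le k 1) j)) = 0)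
    (hg0 : ∑ X : Fin k → (Fin d ⊕ Fin d) → Bool, ∑ Y : Fin k → (Fin d ⊕ Fin d) → Bool,
      massT k d ε P0 P1 X Y * g (Y ⟨k - 1, by omega⟩) = 0)
    (hf2 : ∑ X : Fin k → (Fin d ⊕ Fin d) → Bool, ∑ Y : Fin k → (Fin d ⊕ Fin d) → Bool,
      massT k d ε P0 P1 X Y * (f (X, fun j => Y (Fin.castLE (Nat.sub_le k 1) j))) ^ 2 ≤ 1)
    (hg2 : ∑ X : Fin k → (Fin d ⊕ Fin d) → Bool, ∑ Y : Fin k → (Fin d ⊕ Fin d) → Bool,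
      massT k d ε P0 P1 X Y * (g (Y ⟨k - 1, by omega⟩)) ^ 2 ≤ 1) :
    |∑ X : Fin k → (Fin d ⊕ Fin d) → Bool, ∑ Y : Fin k → (Fin d ⊕ Fin d) → Bool,
        massT k d ε P0 P1 X Y *
          (f (X, fun j => Y (Fin.castLE (Nat.sub_le k 1) j)) * g (Y ⟨k - 1, by omega⟩))|
      ≤ Real.sqrt (1 - ε) := by
  have hP : ∀ a x, 0 ≤ pick P0 P1 a x := by
    rintro (_ | _) x
    · exact hP0 x
    · exact hP1 x
  have hm : ∀ a b, ∑ x ∈ univ.filter (fun x : Fin k → Bool => x ⟨k - 1, by omega⟩ = b),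
      pick P0 P1 a x = 1 / 2 := by
    rintro (_ | _) b
    · exact hP0m _ b
    · exact hP1m _ b
  have hF : ∀ X Y z, f (X, fun j => flipRow ⟨k - 1, by omega⟩ z Y (Fin.castLE (Nat.sub_le k 1) j))
      = f (X, fun j => Y (Fin.castLE (Nat.sub_le k 1) j)) := by
    intro X Y z
    congr 2
    funext j
    refine flipRow_apply_ne ?_ z Y
    intro h
    have hj := congrArg Fin.val h
    have := j.isLt
    simp at hj
    omega
  refine abs_le'.mpr ⟨?_, ?_⟩
  · exact sum_massT_mul_row_le hε.1 hε.2 _ hP hm _ hF g hg0 hf2 hg2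
  · have h := sum_massT_mul_row_le hε.1 hε.2 _ hP hm _ hF (fun y => -g y)
      (by simpa using hg0) hf2 (by simpa using hg2)
    simpa using h
end
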